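/- arXiv:1204.0432 — 7 statements merged into one kernel-verified Lean document; each statement's English description precedes it below -/
import Mathlib

section
/- Let V be a real Banach space. Then E(V) is closed under composition of maps, and for an element p ∈ E(V) the left translation λ_p : E(V) → E(V), q ↦ p ∘ q, is continuous if and only if p is the restriction to B* of the adjoint of some contraction, i.e. p = T*|_{B*} for some T ∈ Θ(V). In other words, the topological center of E(V) is exactly {T*|_{B*} : T ∈ Θ(V)}. -/
open scoped Topology

/-- The closed unit ball of the dual of `V`, with the weak* topology. -/
abbrev DualBall (V : Type*) [NormedAddCommGroup V] [NormedSpace ℝ V] :=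
  {ψ : WeakDual ℝ V // ∀ v : V, |ψ v| ≤ ‖v‖}

/-- The maps `B* → B*` induced by adjoints of contraction operators `T ∈ Θ(V)`. -/
def adjMaps (V : Type*) [NormedAddCommGroup V] [NormedSpace ℝ V] :
    Set (DualBall V → DualBall V) :=
  {p | ∃ T : V →L[ℝ] V, ‖T‖ ≤ 1 ∧ ∀ (ψ : DualBall V) (v : V), (p ψ).1 v = ψ.1 (T v)}

/-- The enveloping semigroup `E(V)` of a Banach space `V`: the pointwise closure of the
adjoint maps of contractions in the product space `(B*)^(B*)`. -/
def EnvSemigroup (V : Type*) [NormedAddCommGroup V] [NormedSpace ℝ V] :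
    Set (DualBall V → DualBall V) :=
  closure (adjMaps V)

/-- A functional bounded by `ε` on a subspace agrees there with one of norm at most `ε`. -/
lemma exists_eqOn_norm_le {E : Type*} [NormedAddCommGroup E] [NormedSpace ℝ E]
    (S : Submodule ℝ E) (F : StrongDual ℝ E) {ε : ℝ} (hε : 0 ≤ ε)
    (h : ∀ x ∈ S, ‖F x‖ ≤ ε * ‖x‖) :
    ∃ g : StrongDual ℝ E, (∀ x ∈ S, g x = F x) ∧ ‖g‖ ≤ ε := by
  obtain ⟨g, hg, hgn⟩ := exists_extension_norm_eq S (F.comp S.subtypeL)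
  refine ⟨g, fun x hx => hg ⟨x, hx⟩, ?_⟩
  rw [hgn]
  exact ContinuousLinearMap.opNorm_le_bound _ hε fun x => h x x.2

lemma ContinuousLinearMap.mem_range_of_forall_exists_norm_sub_le {E F : Type*}
    [NormedAddCommGroup E] [NormedSpace ℝ E] [CompleteSpace E] [NormedAddCommGroup F]
    [NormedSpace ℝ F] (f : E →L[ℝ] F) (hf : ∀ x, ‖f x‖ = ‖x‖) {y : F}
    (h : ∀ ε > 0, ∃ x, ‖y - f x‖ ≤ ε) : ∃ x, f x = y := by
  have hiso : Isometry f := AddMonoidHomClass.isometry_of_norm f hf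
  change y ∈ Set.range f
  rw [← hiso.isClosedEmbedding.isClosed_range.closure_eq, Metric.mem_closure_range_iff]
  intro ε hε
  obtain ⟨x, hx⟩ := h (ε / 2) (half_pos hε)
  exact ⟨x, by rw [dist_eq_norm]; exact hx.trans_lt (half_lt_self hε)⟩

namespace DualBall

variable {V : Type*} [NormedAddCommGroup V] [NormedSpace ℝ V]

/-- An element of the dual ball, viewed as a bounded functional. -/
noncomputable def toDual (ψ : DualBall V) : StrongDual ℝ V := WeakDual.toStrongDual ψ.1

@[simp] lemma toDual_apply (ψ : DualBall V) (v : V) : ψ.toDual v = ψ.1 v := rfl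

lemma norm_toDual_le (ψ : DualBall V) : ‖ψ.toDual‖ ≤ 1 :=
  ContinuousLinearMap.opNorm_le_bound _ zero_le_one fun v => by
    simpa using ψ.2 v

/-- A functional of norm at most one, viewed as an element of the dual ball. -/
noncomputable def ofDual (ψ : StrongDual ℝ V) (h : ‖ψ‖ ≤ 1) : DualBall V :=
  ⟨StrongDual.toWeakDual ψ, fun v => by
    simpa using ψ.le_of_opNorm_le h v⟩

@[simp] lemma ofDual_apply (ψ : StrongDual ℝ V) (h : ‖ψ‖ ≤ 1) (v : V) :
    (ofDual ψ h).1 v = ψ v := rfl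

@[simp] lemma toDual_ofDual (ψ : StrongDual ℝ V) (h : ‖ψ‖ ≤ 1) : (ofDual ψ h).toDual = ψ := rfl

lemma ext_apply {ψ χ : DualBall V} (h : ∀ v, ψ.1 v = χ.1 v) : ψ = χ :=
  Subtype.ext (DFunLike.ext _ _ h)

lemma continuous_eval (v : V) : Continuous fun ψ : DualBall V => ψ.1 v :=
  (WeakDual.eval_continuous v).comp continuous_subtype_val

lemma continuous_of_eval {α : Type*} [TopologicalSpace α] {g : α → DualBall V}
    (h : ∀ v, Continuous fun a => (g a).1 v) : Continuous g :=
  (WeakDual.continuous_of_continuous_eval h).subtype_mk _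

lemma exists_apply_eq_norm (x : V) : ∃ ψ : DualBall V, ψ.1 x = ‖x‖ := by
  obtain ⟨g, hg, hgx⟩ := exists_dual_vector'' ℝ x
  exact ⟨ofDual g hg, by simpa using hgx⟩

lemma eq_of_forall_apply_eq {x y : V} (h : ∀ ψ : DualBall V, ψ.1 x = ψ.1 y) : x = y := by
  obtain ⟨ψ, hψ⟩ := exists_apply_eq_norm (x - y)
  rw [map_sub, h, sub_self] at hψ
  exact sub_eq_zero.1 (norm_eq_zero.1 hψ.symm)

/-- Every functional is its norm times an element of the dual ball. -/
noncomputable def normalize (ψ : StrongDual ℝ V) : DualBall V :=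
  ofDual (‖ψ‖⁻¹ • ψ) <| by
    rw [norm_smul, norm_inv, norm_norm]
    exact inv_mul_le_one

lemma norm_smul_normalize (ψ : StrongDual ℝ V) : ‖ψ‖ • (normalize ψ).toDual = ψ := by
  rcases eq_or_ne ψ 0 with rfl | h
  · simp
  · simp [normalize, smul_smul, norm_ne_zero_iff.2 h]

/-- A functional on the dual that is weak* continuous on the unit ball is approximated in norm
by evaluations. -/
lemma exists_norm_sub_inclusion_le (F : StrongDual ℝ (StrongDual ℝ V))
    (hF : Continuous fun ψ : DualBall V => F ψ.toDual) {ε : ℝ} (hε : 0 < ε) :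
    ∃ x : V, ‖F - NormedSpace.inclusionInDoubleDual ℝ V x‖ ≤ ε := by
  have hind : Topology.IsInducing fun (ψ : DualBall V) (v : V) => ψ.1 v :=
    (Topology.IsInducing.mk rfl : Topology.IsInducing fun (ψ : WeakDual ℝ V) (v : V) => ψ v).comp
      Topology.IsInducing.subtypeVal
  obtain ⟨U, hU, hUF⟩ := hind.isOpen_iff.1 (Metric.isOpen_ball (x := (0 : ℝ)) (ε := ε) |>.preimage hF)
  have h0 : (0 : V → ℝ) ∈ U := by
    have : ofDual (0 : StrongDual ℝ V) (by simp) ∈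
        (fun ψ : DualBall V => F ψ.toDual) ⁻¹' Metric.ball 0 ε := by simp [hε]
    rwa [← hUF] at this
  obtain ⟨I, u, hu, huU⟩ := isOpen_pi_iff.1 hU 0 h0
  let L : I → StrongDual ℝ V →ₗ[ℝ] ℝ := fun i =>
    (NormedSpace.inclusionInDoubleDual ℝ V i.1).toLinearMap
  let S : Subspace ℝ (StrongDual ℝ V) := ⨅ i, LinearMap.ker (L i)
  have hball : ∀ ψ : DualBall V, ψ.toDual ∈ S → |F ψ.toDual| < ε := by
    intro ψ hψ
    have : ψ ∈ (fun ψ : DualBall V => F ψ.toDual) ⁻¹' Metric.ball 0 ε := by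
      rw [← hUF]
      refine huU fun i hi => ?_
      have hz : ψ.1 i = 0 := by
        simpa [L] using (Submodule.mem_iInf _).1 hψ ⟨i, hi⟩
      simpa [hz] using (hu i hi).2
    simpa using this
  have hS : ∀ ψ ∈ S, ‖F ψ‖ ≤ ε * ‖ψ‖ := by
    intro ψ hψ
    have hmem : (normalize ψ).toDual ∈ S := by
      simpa [normalize] using S.smul_mem _ hψ
    have h1 := hball _ hmem
    have h2 : F ψ = ‖ψ‖ * F (normalize ψ).toDual := by
      conv_lhs => rw [← norm_smul_normalize ψ]
      rw [map_smul, smul_eq_mul]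
    rw [h2, norm_mul, norm_norm, mul_comm, Real.norm_eq_abs]
    gcongr
  obtain ⟨g, hg, hgn⟩ := exists_eqOn_norm_le S F hε.le hS
  have hspan : (F - g).toLinearMap ∈ Submodule.span ℝ (Set.range L) := by
    refine mem_span_of_iInf_ker_le_ker fun ψ hψ => ?_
    have := hg ψ hψ
    simp [this]
  have hrange : Submodule.span ℝ (Set.range L) ≤ LinearMap.range
      ((ContinuousLinearMap.coeLM ℝ).comp
        (NormedSpace.inclusionInDoubleDual ℝ V).toLinearMap) := by
    rw [Submodule.span_le]
    rintro _ ⟨i, rfl⟩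
    exact ⟨i.1, rfl⟩
  obtain ⟨x, hx⟩ := hrange hspan
  have hx' : NormedSpace.inclusionInDoubleDual ℝ V x = F - g :=
    ContinuousLinearMap.coe_injective hx
  refine ⟨x, ?_⟩
  have hFg : F - (F - g) = g := by abel
  rw [hx', hFg]
  exact hgn

/-- On a complete space, a functional on the dual that is weak* continuous on the unit ball is
an evaluation. -/
lemma exists_eq_inclusion [CompleteSpace V] (F : StrongDual ℝ (StrongDual ℝ V))
    (hF : Continuous fun ψ : DualBall V => F ψ.toDual) :
    ∃ x : V, NormedSpace.inclusionInDoubleDual ℝ V x = F := by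
  refine ContinuousLinearMap.mem_range_of_forall_exists_norm_sub_le
    (F := StrongDual ℝ (StrongDual ℝ V)) (NormedSpace.inclusionInDoubleDual ℝ V) ?_ ?_
  · intro x
    exact (NormedSpace.inclusionInDoubleDualLi (E := V) ℝ).norm_map x
  · exact fun ε hε => exists_norm_sub_inclusion_le F hF hε

end DualBall

namespace EnvSemigroup

variable {V : Type*} [NormedAddCommGroup V] [NormedSpace ℝ V]

lemma continuous_of_mem_adjMaps {p : DualBall V → DualBall V} (hp : p ∈ adjMaps V) :
    Continuous p := by
  obtain ⟨T, -, hT⟩ := hp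
  refine DualBall.continuous_of_eval fun v => ?_
  simpa only [hT] using DualBall.continuous_eval (T v)

lemma comp_mem_adjMaps {p q : DualBall V → DualBall V} (hp : p ∈ adjMaps V)
    (hq : q ∈ adjMaps V) : p ∘ q ∈ adjMaps V := by
  obtain ⟨S, hS, hpS⟩ := hp
  obtain ⟨T, hT, hqT⟩ := hq
  refine ⟨T.comp S, (T.opNorm_comp_le S).trans (mul_le_one₀ hT (norm_nonneg _) hS), ?_⟩
  intro ψ v
  simp [hpS, hqT]

lemma continuous_left_comp {p : DualBall V → DualBall V} (hp : Continuous p) :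
    Continuous fun q : DualBall V → DualBall V => p ∘ q :=
  continuous_pi fun ψ => hp.comp (continuous_apply ψ)

lemma comp_mem {p q : DualBall V → DualBall V} (hp : p ∈ EnvSemigroup V)
    (hq : q ∈ EnvSemigroup V) : p ∘ q ∈ EnvSemigroup V := by
  have h1 : ∀ s ∈ adjMaps V, s ∘ q ∈ EnvSemigroup V := fun s hs =>
    map_mem_closure (continuous_left_comp (continuous_of_mem_adjMaps hs)) hq
      fun r hr => comp_mem_adjMaps hs hr
  have hcont : Continuous fun r : DualBall V → DualBall V => r ∘ q :=
    continuous_pi fun ψ => continuous_apply (q ψ)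
  have h2 : p ∘ q ∈ closure (EnvSemigroup V) := map_mem_closure (f := fun r => r ∘ q) hcont hp h1
  rwa [EnvSemigroup, closure_closure] at h2

lemma apply_linear {p : DualBall V → DualBall V} (hp : p ∈ EnvSemigroup V) {a b c : ℝ}
    {ψ χ ω : DualBall V} (h : c • ω.toDual = a • ψ.toDual + b • χ.toDual) (v : V) :
    c * (p ω).1 v = a * (p ψ).1 v + b * (p χ).1 v := by
  have hev : ∀ φ : DualBall V, Continuous fun r : DualBall V → DualBall V => (r φ).1 v :=
    fun φ => (DualBall.continuous_eval v).comp (continuous_apply φ)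
  have hcl : IsClosed {r : DualBall V → DualBall V |
      c * (r ω).1 v = a * (r ψ).1 v + b * (r χ).1 v} :=
    isClosed_eq ((hev ω).const_mul c) (((hev ψ).const_mul a).add ((hev χ).const_mul b))
  refine closure_minimal ?_ hcl hp
  rintro r ⟨T, -, hT⟩
  simpa [hT] using DFunLike.congr_fun h (T v)

/-- The coordinates of an element of `E(V)` extend to bounded functionals on the dual. -/
lemma exists_dual_extension {p : DualBall V → DualBall V} (hp : p ∈ EnvSemigroup V) (v : V) :
    ∃ F : StrongDual ℝ (StrongDual ℝ V), ∀ ψ : DualBall V, F ψ.toDual = (p ψ).1 v := by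
  let f : StrongDual ℝ V →ₗ[ℝ] ℝ :=
    { toFun := fun ψ => ‖ψ‖ * (p (DualBall.normalize ψ)).1 v
      map_add' := fun ψ χ => apply_linear hp (by simp only [DualBall.norm_smul_normalize]) v
      map_smul' := fun c ψ => by
        have := apply_linear hp (c := ‖c • ψ‖) (a := c * ‖ψ‖) (b := 0)
          (ω := DualBall.normalize (c • ψ)) (ψ := DualBall.normalize ψ)
          (χ := DualBall.normalize ψ)
          (by rw [mul_smul]; simp only [DualBall.norm_smul_normalize, zero_smul, add_zero]) v
        simpa [mul_assoc] using this }
  refine ⟨f.mkContinuous ‖v‖ fun ψ => ?_, fun ψ => ?_⟩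
  · change ‖‖ψ‖ * (p (DualBall.normalize ψ)).1 v‖ ≤ ‖v‖ * ‖ψ‖
    rw [norm_mul, norm_norm, mul_comm]
    gcongr
    exact (p _).2 v
  · have := apply_linear hp (c := ‖ψ.toDual‖) (a := 1) (b := 0)
      (ω := DualBall.normalize ψ.toDual) (ψ := ψ) (χ := ψ)
      (by simp [DualBall.norm_smul_normalize]) v
    change ‖ψ.toDual‖ * (p (DualBall.normalize ψ.toDual)).1 v = (p ψ).1 v
    simpa using this

lemma mem_adjMaps_of_continuous [CompleteSpace V] {p : DualBall V → DualBall V}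
    (hp : p ∈ EnvSemigroup V) (hc : Continuous p) : p ∈ adjMaps V := by
  have key : ∀ v : V, ∃ x : V, ∀ ψ : DualBall V, (p ψ).1 v = ψ.1 x := by
    intro v
    obtain ⟨F, hF⟩ := exists_dual_extension hp v
    obtain ⟨x, rfl⟩ := DualBall.exists_eq_inclusion F
      (by simp only [hF]; exact (DualBall.continuous_eval v).comp hc)
    exact ⟨x, fun ψ => (hF ψ).symm⟩
  choose T hT using key
  let S : V →ₗ[ℝ] V :=
    { toFun := T
      map_add' := fun v w => DualBall.eq_of_forall_apply_eq fun ψ => by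
        rw [← hT, map_add, map_add, hT, hT]
      map_smul' := fun c v => DualBall.eq_of_forall_apply_eq fun ψ => by
        rw [← hT, map_smul, map_smul, hT, RingHom.id_apply] }
  have hS : ∀ v, ‖S v‖ ≤ 1 * ‖v‖ := fun v => by
    obtain ⟨ψ, hψ⟩ := DualBall.exists_apply_eq_norm (T v)
    rw [one_mul]
    change ‖T v‖ ≤ ‖v‖
    rw [← hψ, ← hT]
    exact (le_abs_self _).trans ((p ψ).2 v)
  exact ⟨S.mkContinuous 1 hS, S.mkContinuous_norm_le zero_le_one hS, fun ψ v => hT v ψ⟩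

/-- The adjoint map of the contraction `v ↦ ψ v • x`. -/
noncomputable def rankOne (x : V) (hx : ‖x‖ ≤ 1) (ψ : DualBall V) : DualBall V → DualBall V := fun χ =>
  DualBall.ofDual (χ.1 x • ψ.toDual) <| by
    rw [norm_smul]
    exact mul_le_one₀ ((χ.2 x).trans hx) (norm_nonneg _) ψ.norm_toDual_le

@[simp] lemma rankOne_apply (x : V) (hx : ‖x‖ ≤ 1) (ψ χ : DualBall V) (v : V) :
    (rankOne x hx ψ χ).1 v = χ.1 x * ψ.1 v := rfl

lemma rankOne_mem (x : V) (hx : ‖x‖ ≤ 1) (ψ : DualBall V) : rankOne x hx ψ ∈ adjMaps V := by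
  refine ⟨ψ.toDual.smulRight x, ?_, fun χ v => ?_⟩
  · rw [ContinuousLinearMap.norm_smulRight_apply]
    exact mul_le_one₀ ψ.norm_toDual_le (norm_nonneg _) hx
  · simp [mul_comm]

lemma continuous_rankOne (x : V) (hx : ‖x‖ ≤ 1) : Continuous (rankOne x hx) :=
  continuous_pi fun χ => DualBall.continuous_of_eval fun v => by
    simpa only [rankOne_apply] using (DualBall.continuous_eval v).const_mul (χ.1 x)

lemma continuous_of_continuous_translation {p : DualBall V → DualBall V}
    (h : Continuous fun q : EnvSemigroup V => p ∘ (q : DualBall V → DualBall V)) :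
    Continuous p := by
  rcases subsingleton_or_nontrivial V with hV | hV
  · refine DualBall.continuous_of_eval fun v => ?_
    simpa [Subsingleton.elim v 0] using continuous_const
  · obtain ⟨x, hx⟩ := exists_norm_eq V zero_le_one
    obtain ⟨φ, hφ⟩ := DualBall.exists_apply_eq_norm x
    have hr : Continuous fun ψ : DualBall V =>
        (⟨rankOne x hx.le ψ, subset_closure (rankOne_mem x hx.le ψ)⟩ : EnvSemigroup V) :=
      (continuous_rankOne x hx.le).subtype_mk _
    have hc := (continuous_apply φ).comp (h.comp hr)
    refine hc.congr fun ψ => congrArg p (DualBall.ext_apply fun v => ?_)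
    simp [hφ, hx]

end EnvSemigroup

/-- `E(V)` is closed under composition, and for `p ∈ E(V)` the left
translation `q ↦ p ∘ q` is continuous iff `p` comes from the adjoint of a contraction;
i.e. the topological center of `E(V)` is exactly `{T*|_{B*} : T ∈ Θ(V)}`. -/
theorem stmt1 (V : Type*) [NormedAddCommGroup V] [NormedSpace ℝ V] [CompleteSpace V] :
    (∀ p ∈ EnvSemigroup V, ∀ q ∈ EnvSemigroup V, p ∘ q ∈ EnvSemigroup V) ∧
    (∀ p ∈ EnvSemigroup V,
      ((Continuous fun q : EnvSemigroup V => p ∘ (q : DualBall V → DualBall V)) ↔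
        p ∈ adjMaps V)) := by
  refine ⟨fun p hp q hq => EnvSemigroup.comp_mem hp hq, fun p hp => ⟨fun h => ?_, fun h => ?_⟩⟩
  · exact EnvSemigroup.mem_adjMaps_of_continuous hp
      (EnvSemigroup.continuous_of_continuous_translation h)
  · exact (EnvSemigroup.continuous_left_comp
      (EnvSemigroup.continuous_of_mem_adjMaps h)).comp continuous_subtype_val
end

section
/- For a real Banach space V the following conditions are equivalent: (i) V is a Rosenthal Banach space (V contains no isomorphic copy of ℓ¹); (ii) every element p ∈ E(V) is a fragmented map from B* (with the weak* topology) to B* (with its unique compatible uniformity); (iii) for every p ∈ E(V) the left translation λ_p : E(V) → E(V), q ↦ p ∘ q, is a fragmented self-map of the compact space E(V) (E(V) is a tame semigroup). -/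
open scoped Topology

/-- `V` contains an isomorphic copy of `ℓ¹ = ℓ¹(ℕ, ℝ)`. -/
def ContainsL1Copy (V : Type*) [NormedAddCommGroup V] [NormedSpace ℝ V] : Prop :=
  ∃ f : lp (fun _ : ℕ => ℝ) 1 →L[ℝ] V, ∃ c : ℝ, 0 < c ∧ ∀ x, c * ‖x‖ ≤ ‖f x‖

/-- A map `p` from a topological space `X` to a (compact Hausdorff) space `Y` is fragmented
if for every nonempty `A ⊆ X` and every entourage `ε` (a neighborhood of the diagonal of
`Y`, i.e. a member of the unique compatible uniformity of the compact Hausdorff space `Y`)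
there is an open `O` meeting `A` with `p (O ∩ A)` `ε`-small. -/
def IsFragmentedMap {X Y : Type*} [TopologicalSpace X] [TopologicalSpace Y]
    (p : X → Y) : Prop :=
  ∀ A : Set X, A.Nonempty → ∀ ε ∈ nhdsSet (Set.diagonal Y),
    ∃ O : Set X, IsOpen O ∧ (O ∩ A).Nonempty ∧
      ∀ a ∈ O ∩ A, ∀ b ∈ O ∩ A, (p a, p b) ∈ ε

/-- A real function is fragmented when every nonempty set has a nonempty relatively open subset
of arbitrarily small oscillation. -/
def RealFragmented {X : Type*} [TopologicalSpace X] (h : X → ℝ) : Prop :=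
  ∀ A : Set X, A.Nonempty → ∀ ε > 0,
    ∃ O : Set X, IsOpen O ∧ (O ∩ A).Nonempty ∧ ∀ a ∈ O ∩ A, ∀ b ∈ O ∩ A, |h a - h b| < ε

theorem exists_open_finset_osc_lt {X ι : Type*} [TopologicalSpace X] {h : ι → X → ℝ}
    (hh : ∀ i, RealFragmented (h i)) (F : Finset (ι × ℕ)) {A : Set X} (hA : A.Nonempty) :
    ∃ O : Set X, IsOpen O ∧ (O ∩ A).Nonempty ∧
      ∀ k ∈ F, ∀ a ∈ O ∩ A, ∀ b ∈ O ∩ A, |h k.1 a - h k.1 b| < 1 / ((k.2 : ℝ) + 1) := by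
  classical
  induction F using Finset.induction_on with
  | empty => exact ⟨Set.univ, isOpen_univ, by simpa using hA, by simp⟩
  | insert k F _ ih =>
    obtain ⟨O, hO, hne, hosc⟩ := ih
    obtain ⟨O', hO', hne', hosc'⟩ := hh k.1 (O ∩ A) hne (1 / ((k.2 : ℝ) + 1)) (by positivity)
    refine ⟨O' ∩ O, hO'.inter hO, by rwa [Set.inter_assoc], fun l hl a ha b hb => ?_⟩
    rw [Set.inter_assoc] at ha hb
    rcases Finset.mem_insert.1 hl with rfl | hl
    · exact hosc' a ha b hb
    · exact hosc l hl a ha.2 b hb.2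

theorem isFragmentedMap_of_realFragmented {X Y ι : Type*} [TopologicalSpace X]
    [TopologicalSpace Y] [CompactSpace Y] {p : X → Y} (g : ι → Y → ℝ)
    (hg : ∀ i, Continuous (g i)) (hsep : ∀ x y, (∀ i, g i x = g i y) → x = y)
    (hp : ∀ i, RealFragmented fun x => g i (p x)) : IsFragmentedMap p := by
  intro A hA ε hε
  obtain ⟨W, hWo, hdW, hWε⟩ := mem_nhdsSet_iff_exists.1 hε
  have hK : IsCompact (Wᶜ : Set (Y × Y)) := hWo.isClosed_compl.isCompact
  let U : ι × ℕ → Set (Y × Y) := fun k => {z | 1 / ((k.2 : ℝ) + 1) < |g k.1 z.1 - g k.1 z.2|}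
  have hU : ∀ k, IsOpen (U k) := fun k => isOpen_lt continuous_const
    ((((hg k.1).comp continuous_fst).sub ((hg k.1).comp continuous_snd)).abs)
  have hcov : (Wᶜ : Set (Y × Y)) ⊆ ⋃ k, U k := by
    rintro ⟨x, y⟩ hxy
    have hne : x ≠ y := fun h => hxy (hdW (by simpa using h))
    obtain ⟨i, hi⟩ : ∃ i, g i x ≠ g i y := by
      by_contra! hcon
      exact hne (hsep x y hcon)
    obtain ⟨n, hn⟩ := exists_nat_one_div_lt (abs_pos.2 (sub_ne_zero.2 hi))
    exact Set.mem_iUnion.2 ⟨(i, n), hn⟩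
  obtain ⟨F, hF⟩ := hK.elim_finite_subcover U hU hcov
  obtain ⟨O, hO, hne, hosc⟩ := exists_open_finset_osc_lt hp F hA
  refine ⟨O, hO, hne, fun a ha b hb => hWε ?_⟩
  by_contra hab
  obtain ⟨k, hk, hkab⟩ := Set.mem_iUnion₂.1 (hF hab)
  exact lt_asymm hkab (hosc k hk a ha b hb)

theorem IsFragmentedMap.realFragmented {X Y : Type*} [TopologicalSpace X] [TopologicalSpace Y]
    {p : X → Y} (hp : IsFragmentedMap p) {g : Y → ℝ} (hg : Continuous g) :
    RealFragmented fun x => g (p x) := by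
  intro A hA ε hε
  refine hp A hA {z | |g z.1 - g z.2| < ε} ?_
  refine IsOpen.mem_nhdsSet ?_ |>.2 ?_
  · exact isOpen_lt ((hg.comp continuous_fst).sub (hg.comp continuous_snd)).abs continuous_const
  · rintro ⟨x, y⟩ hxy
    obtain rfl : x = y := by simpa using hxy
    simpa using hε

theorem RealFragmented.comp_continuous {X Y : Type*} [TopologicalSpace X] [TopologicalSpace Y]
    {h : Y → ℝ} (hh : RealFragmented h) {g : X → Y} (hg : Continuous g) :
    RealFragmented fun x => h (g x) := by
  intro A hA ε hε
  obtain ⟨O, hO, ⟨_, hyO, x, hx, rfl⟩, hosc⟩ := hh (g '' A) (hA.image g) ε hε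
  exact ⟨g ⁻¹' O, hO.preimage hg, ⟨x, hyO, hx⟩, fun a ha b hb =>
    hosc _ ⟨ha.1, _, ha.2, rfl⟩ _ ⟨hb.1, _, hb.2, rfl⟩⟩

/-- A bounded function that is not fragmented takes values below `α` and above `β` densely
on some nonempty set, for some `α < β`. -/
theorem exists_dense_gap_of_not_realFragmented {X : Type*} [TopologicalSpace X] {h : X → ℝ}
    {R : ℝ} (hR : ∀ x, |h x| ≤ R) (hh : ¬ RealFragmented h) :
    ∃ B : Set X, B.Nonempty ∧ ∃ α β : ℝ, α < β ∧ ∀ O : Set X, IsOpen O → (O ∩ B).Nonempty →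
      (∃ y ∈ O ∩ B, h y < α) ∧ ∃ y ∈ O ∩ B, β < h y := by
  unfold RealFragmented at hh
  push Not at hh
  obtain ⟨A, hA, ε, hε, hosc⟩ := hh
  let δ := ε / 4
  have hδ : 0 < δ := by positivity
  let bin : X → ℤ := fun x => ⌊h x / δ⌋
  have hbin : ∀ x, (bin x : ℝ) * δ ≤ h x ∧ h x < (bin x + 1) * δ := fun x =>
    ⟨(le_div_iff₀ hδ).1 (Int.floor_le _), (div_lt_iff₀ hδ).1 (Int.lt_floor_add_one _)⟩
  have hfin : (Set.range bin).Finite := by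
    refine (Set.finite_Icc ⌊-R / δ⌋ ⌊R / δ⌋).subset ?_
    rintro _ ⟨x, rfl⟩
    have := abs_le.1 (hR x)
    exact ⟨Int.floor_le_floor (by gcongr; exact this.1),
      Int.floor_le_floor (by gcongr; exact this.2)⟩
  have hfin' : ∀ S : Set X, (bin '' S).Finite := fun S => hfin.subset (Set.image_subset_range _ _)
  let P : Set (Set X) := {O | IsOpen O ∧ (O ∩ A).Nonempty}
  have hP : P.Nonempty := ⟨Set.univ, isOpen_univ, by simpa using hA⟩
  let m : Set X → ℕ := fun O => (bin '' (O ∩ A)).ncard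
  obtain ⟨O, ⟨hO, hOne⟩, hmin⟩ : ∃ O ∈ P, ∀ O' ∈ P, m O ≤ m O' :=
    ⟨_, Function.argminOn_mem m P hP, fun O' hO' => Function.argminOn_le m P hO'⟩
  obtain ⟨a, ha, b, hb, hab⟩ : ∃ a ∈ O ∩ A, ∃ b ∈ O ∩ A, h a + ε ≤ h b := by
    obtain ⟨a, ha, b, hb, hab⟩ := hosc O hO hOne
    rcases le_abs'.1 hab with hab | hab
    · exact ⟨a, ha, b, hb, by linarith⟩
    · exact ⟨b, hb, a, ha, by linarith⟩
  refine ⟨O ∩ A, hOne, (bin a + 1) * δ, (bin a + 2) * δ, by linarith, fun O' hO' hne => ?_⟩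
  rw [← Set.inter_assoc] at hne ⊢
  have himage : bin '' (O' ∩ O ∩ A) = bin '' (O ∩ A) :=
    Set.eq_of_subset_of_ncard_le
      (Set.image_mono (Set.inter_subset_inter_left _ Set.inter_subset_right))
      (hmin _ ⟨hO'.inter hO, hne⟩) (hfin' _)
  have hval : ∀ x ∈ O ∩ A, ∃ y ∈ O' ∩ O ∩ A, bin y = bin x := fun x hx => by
    have := Set.mem_image_of_mem bin hx
    rwa [← himage] at this
  have hδε : ε = 4 * δ := by simp only [δ]; ring
  obtain ⟨y, hy, hya⟩ := hval a ha
  obtain ⟨z, hz, hzb⟩ := hval b hb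
  refine ⟨⟨y, hy, hya ▸ (hbin y).2⟩, z, hz, ?_⟩
  have h1 := hbin a
  have h2 := hbin b
  have h3 := hbin z
  rw [hzb] at h3
  linarith [h1.1, h2.2, h3.1]

instance (V : Type*) [NormedAddCommGroup V] [NormedSpace ℝ V] : CompactSpace (DualBall V) := by
  have h : {ψ : WeakDual ℝ V | ∀ v : V, |ψ v| ≤ ‖v‖} =
      WeakDual.toStrongDual ⁻¹' Metric.closedBall 0 1 := by
    ext ψ
    simp only [Set.mem_ofPred_eq, Set.mem_preimage, mem_closedBall_zero_iff]
    rw [ContinuousLinearMap.opNorm_le_iff zero_le_one]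
    simp
  have hc : IsCompact {ψ : WeakDual ℝ V | ∀ v : V, |ψ v| ≤ ‖v‖} := by
    rw [h]
    exact WeakDual.isCompact_closedBall 0 1
  exact isCompact_iff_compactSpace.1 hc

instance (V : Type*) [NormedAddCommGroup V] [NormedSpace ℝ V] : CompactSpace (EnvSemigroup V) :=
  isCompact_iff_compactSpace.1 isClosed_closure.isCompact

section

variable {V : Type*} [NormedAddCommGroup V] [NormedSpace ℝ V]

theorem DualBall.continuous_eval_s5 (v : V) : Continuous fun ψ : DualBall V => ψ.1 v :=
  (WeakDual.eval_continuous v).comp continuous_subtype_val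

theorem DualBall.continuous_of_eval_s5 {X : Type*} [TopologicalSpace X] {g : X → DualBall V}
    (hg : ∀ v, Continuous fun x => (g x).1 v) : Continuous g :=
  Continuous.subtype_mk (WeakDual.continuous_of_continuous_eval hg) _

/-- The functional `φ` of norm at most one, as a point of the dual ball. -/
noncomputable def DualBall.mk (φ : StrongDual ℝ V) (hφ : ‖φ‖ ≤ 1) : DualBall V :=
  ⟨StrongDual.toWeakDual φ, fun v => by
    simpa using φ.le_of_opNorm_le hφ v⟩

/-- The map of the dual ball induced by the adjoint of a contraction. -/
noncomputable def adjMap (T : V →L[ℝ] V) (hT : ‖T‖ ≤ 1) (ψ : DualBall V) : DualBall V :=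
  ⟨StrongDual.toWeakDual ((WeakDual.toStrongDual ψ.1).comp T), fun v =>
    (ψ.2 (T v)).trans (by simpa using T.le_of_opNorm_le hT v)⟩

theorem adjMap_apply (T : V →L[ℝ] V) (hT : ‖T‖ ≤ 1) (ψ : DualBall V) (v : V) :
    (adjMap T hT ψ).1 v = ψ.1 (T v) := rfl

theorem adjMap_mem (T : V →L[ℝ] V) (hT : ‖T‖ ≤ 1) : adjMap T hT ∈ EnvSemigroup V :=
  subset_closure ⟨T, hT, fun _ _ => rfl⟩

theorem continuous_of_mem_adjMaps {p : DualBall V → DualBall V} (hp : p ∈ adjMaps V) :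
    Continuous p := by
  obtain ⟨T, -, hT⟩ := hp
  refine DualBall.continuous_of_eval_s5 fun v => ?_
  simpa only [hT] using DualBall.continuous_eval_s5 (T v)

theorem EnvSemigroup.comp_mem_s5 {p q : DualBall V → DualBall V} (hp : p ∈ EnvSemigroup V)
    (hq : q ∈ EnvSemigroup V) : p ∘ q ∈ EnvSemigroup V := by
  have key : ∀ s ∈ adjMaps V, s ∘ q ∈ EnvSemigroup V := by
    intro s hs
    have hcont : Continuous fun r : DualBall V → DualBall V => s ∘ r :=
      continuous_pi fun ψ => (continuous_of_mem_adjMaps hs).comp (continuous_apply ψ)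
    refine map_mem_closure hcont hq ?_
    rintro r ⟨T, hT, hrT⟩
    obtain ⟨S, hS, hsS⟩ := hs
    refine ⟨T.comp S, (T.opNorm_comp_le S).trans ?_, fun ψ v => ?_⟩
    · exact mul_le_one₀ hT (norm_nonneg _) hS
    · simp [hsS, hrT]
  have hcont : Continuous fun r : DualBall V → DualBall V => r ∘ q :=
    continuous_pi fun ψ => continuous_apply (q ψ)
  have := map_mem_closure hcont hp key
  rwa [EnvSemigroup, closure_closure] at this

theorem EnvSemigroup.continuous_eval_s5 (ψ : DualBall V) (v : V) :
    Continuous fun q : EnvSemigroup V => (q.1 ψ).1 v :=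
  (DualBall.continuous_eval_s5 v).comp ((continuous_apply ψ).comp continuous_subtype_val)

/-- If all elements of `E(V)` are fragmented, so are all left translations. -/
theorem EnvSemigroup.isFragmentedMap_leftTranslation {p : DualBall V → DualBall V}
    (hp : IsFragmentedMap p) (f : EnvSemigroup V → EnvSemigroup V)
    (hf : ∀ q : EnvSemigroup V, (f q : DualBall V → DualBall V) = p ∘ q.1) :
    IsFragmentedMap f := by
  refine isFragmentedMap_of_realFragmented (ι := DualBall V × V) (fun i q => (q.1 i.1).1 i.2)
    (fun i => EnvSemigroup.continuous_eval_s5 i.1 i.2) ?_ ?_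
  · intro q r h
    ext ψ : 3
    exact ContinuousLinearMap.ext fun v => h (ψ, v)
  · rintro ⟨ψ, v⟩
    simp only [hf]
    exact (hp.realFragmented (DualBall.continuous_eval_s5 v)).comp_continuous
      ((continuous_apply ψ).comp continuous_subtype_val)

/-- The space `V` contains `ℓ¹` as soon as it contains a bounded sequence satisfying a lower
`ℓ¹`-estimate. -/
theorem containsL1Copy_of_lower_estimate [CompleteSpace V] (v : ℕ → V) {R d : ℝ}
    (hR : ∀ n, ‖v n‖ ≤ R) (hd : 0 < d)
    (hv : ∀ (a : ℕ → ℝ) (n : ℕ),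
      d * ∑ i ∈ Finset.range n, |a i| ≤ ‖∑ i ∈ Finset.range n, a i • v i‖) :
    ContainsL1Copy V := by
  have habs : ∀ x : lp (fun _ : ℕ => ℝ) 1, HasSum (fun n => |x n|) ‖x‖ := fun x => by
    simpa using lp.hasSum_norm (by simp) x
  have hbound : ∀ (x : lp (fun _ : ℕ => ℝ) 1) n, ‖x n • v n‖ ≤ |x n| * R := fun x n => by
    rw [norm_smul, Real.norm_eq_abs]
    exact mul_le_mul_of_nonneg_left (hR n) (abs_nonneg _)
  have hsum : ∀ x : lp (fun _ : ℕ => ℝ) 1, Summable fun n => x n • v n := fun x =>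
    Summable.of_norm_bounded ((habs x).summable.mul_right R) (hbound x)
  let L : lp (fun _ : ℕ => ℝ) 1 →ₗ[ℝ] V :=
    { toFun := fun x => ∑' n, x n • v n
      map_add' := fun x y => by
        rw [← (hsum x).tsum_add (hsum y)]
        exact tsum_congr fun n => by simp [add_smul]
      map_smul' := fun c x => by
        rw [RingHom.id_apply, ← (hsum x).tsum_const_smul]
        exact tsum_congr fun n => by simp [mul_smul] }
  have hL : ∀ x, ‖L x‖ ≤ R * ‖x‖ := fun x => by
    rw [mul_comm]
    exact tsum_of_norm_bounded ((habs x).mul_right R) (hbound x)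
  refine ⟨L.mkContinuous R hL, d, hd, fun x => ?_⟩
  exact le_of_tendsto_of_tendsto' ((habs x).tendsto_sum_nat.const_mul d)
    (hsum x).hasSum.tendsto_sum_nat.norm (hv x)

/-- On the finite set `F`, every sign pattern is realised by a point of `B`, with values
below `α` and above `β`. -/
def IsIndependentOn (B : Set (DualBall V)) (α β : ℝ) (F : Set V) : Prop :=
  ∀ G : Set V, ∃ ψ ∈ B, ∀ v ∈ F, (v ∈ G → β < ψ.1 v) ∧ (v ∉ G → ψ.1 v < α)

theorem IsIndependentOn.mono {B : Set (DualBall V)} {α β : ℝ} {F F' : Set V}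
    (h : IsIndependentOn B α β F) (hF : F' ⊆ F) : IsIndependentOn B α β F' := fun G =>
  let ⟨ψ, hψ, h'⟩ := h G
  ⟨ψ, hψ, fun v hv => h' v (hF hv)⟩

/-- An infinite bounded independent set of vectors yields a copy of `ℓ¹`. -/
theorem containsL1Copy_of_isIndependentOn [CompleteSpace V] {B : Set (DualBall V)} {α β R : ℝ}
    (hαβ : α < β) {S : Set V} (hS : S.Infinite) (hR : ∀ v ∈ S, ‖v‖ ≤ R)
    (hind : ∀ F ⊆ S, F.Finite → IsIndependentOn B α β F) : ContainsL1Copy V := by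
  have := hS.to_subtype
  let e : ℕ ↪ S := Infinite.natEmbedding S
  have he : Function.Injective fun n => (e n : V) := Subtype.val_injective.comp e.injective
  refine containsL1Copy_of_lower_estimate (fun n => (e n : V)) (d := (β - α) / 2)
    (fun n => hR _ (e n).2) (by linarith) fun a n => ?_
  have hF : IsIndependentOn B α β ((fun n => (e n : V)) '' Finset.range n) :=
    hind _ (by rintro _ ⟨i, -, rfl⟩; exact (e i).2) ((Finset.finite_toSet _).image _)
  let G : Set V := (fun n => (e n : V)) '' {i | 0 ≤ a i}
  have hG : ∀ i, (e i : V) ∈ G ↔ 0 ≤ a i := fun i => he.mem_set_image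
  obtain ⟨ψ, -, hψ⟩ := hF G
  obtain ⟨χ, -, hχ⟩ := hF Gᶜ
  set w := ∑ i ∈ Finset.range n, a i • (e i : V) with hw
  have hterm : ∀ i ∈ Finset.range n,
      (β - α) * |a i| ≤ a i * ψ.1 (e i) - a i * χ.1 (e i) := fun i hi => by
    have h1 := hψ (e i) ⟨i, hi, rfl⟩
    have h2 := hχ (e i) ⟨i, hi, rfl⟩
    simp only [Set.mem_compl_iff, hG, not_not] at h1 h2
    rcases le_or_gt 0 (a i) with h | h
    · rw [abs_of_nonneg h]
      nlinarith [h1.1 h, h2.2 h]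
    · rw [abs_of_neg h]
      nlinarith [h1.2 h.not_ge, h2.1 h.not_ge]
  have hsum : (β - α) * ∑ i ∈ Finset.range n, |a i| ≤ ψ.1 w - χ.1 w := by
    rw [Finset.mul_sum]
    refine (Finset.sum_le_sum hterm).trans_eq ?_
    simp [hw, Finset.sum_sub_distrib]
  have h1 := (le_abs_self _).trans (ψ.2 w)
  have h2 := (neg_le_abs _).trans (χ.2 w)
  linarith

/-- In a Banach space without a copy of `ℓ¹`, every element of `E(V)` is fragmented. -/
theorem EnvSemigroup.isFragmentedMap [CompleteSpace V] (hV : ¬ ContainsL1Copy V)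
    {p : DualBall V → DualBall V} (hp : p ∈ EnvSemigroup V) : IsFragmentedMap p := by
  refine isFragmentedMap_of_realFragmented (fun (v : V) (ψ : DualBall V) => ψ.1 v)
    DualBall.continuous_eval_s5 (fun ψ χ h => Subtype.ext (ContinuousLinearMap.ext h)) fun v₀ => ?_
  by_contra hnot
  obtain ⟨B, hB, α, β, hαβ, hgap⟩ :=
    exists_dense_gap_of_not_realFragmented (fun ψ => (p ψ).2 v₀) hnot
  let 𝓕 : Set (Set V) :=
    {S | ∀ F ⊆ S, F.Finite → IsIndependentOn B α β F ∧ ∀ v ∈ F, ‖v‖ ≤ ‖v₀‖}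
  have hchar : Order.IsOfFiniteCharacter 𝓕 := fun S =>
    ⟨fun hS F hF _ F' hF' hfin => hS F' (hF'.trans hF) hfin,
      fun hS F hF hfin => hS F hF hfin F subset_rfl hfin⟩
  have hempty : (∅ : Set V) ∈ 𝓕 := fun F hF _ => by
    obtain rfl := Set.subset_empty_iff.1 hF
    exact ⟨fun G => ⟨hB.some, hB.some_mem, by simp⟩, by simp⟩
  obtain ⟨S, -, hS⟩ := hchar.exists_maximal hempty
  have hSinf : S.Infinite := by
    intro hfin
    have hSind := (hS.prop S subset_rfl hfin).1
    have hcell : ∀ G : Set V, ∃ y ∈ B, ∃ z ∈ B, (p y).1 v₀ < α ∧ β < (p z).1 v₀ ∧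
        ∀ v ∈ S, ((v ∈ G → β < y.1 v) ∧ (v ∉ G → y.1 v < α)) ∧
          ((v ∈ G → β < z.1 v) ∧ (v ∉ G → z.1 v < α)) := by
      intro G
      let O : Set (DualBall V) :=
        ⋂ v ∈ S, {ψ | (v ∈ G → β < ψ.1 v) ∧ (v ∉ G → ψ.1 v < α)}
      have hO : IsOpen O := by
        refine hfin.isOpen_biInter fun v _ => ?_
        by_cases hv : v ∈ G
        · simpa [hv] using isOpen_lt continuous_const (DualBall.continuous_eval_s5 v)
        · simpa [hv] using isOpen_lt (DualBall.continuous_eval_s5 v) continuous_const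
      obtain ⟨ψ, hψB, hψ⟩ := hSind G
      obtain ⟨⟨y, hy, hyα⟩, z, hz, hzβ⟩ := hgap O hO ⟨ψ, Set.mem_iInter₂.2 hψ, hψB⟩
      exact ⟨y, hy.2, z, hz.2, hyα, hzβ, fun v hv =>
        ⟨Set.mem_iInter₂.1 hy.1 v hv, Set.mem_iInter₂.1 hz.1 v hv⟩⟩
    choose y hyB z hzB hy hz hyz using hcell
    let N : Set (DualBall V → DualBall V) :=
      ⋂ G ∈ 𝒫 S, {q | (q (y G)).1 v₀ < α ∧ β < (q (z G)).1 v₀}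
    have hc : ∀ ψ : DualBall V, Continuous fun q : DualBall V → DualBall V => (q ψ).1 v₀ :=
      fun ψ => (DualBall.continuous_eval_s5 v₀).comp (continuous_apply ψ)
    have hN : IsOpen N := hfin.finite_subsets.isOpen_biInter fun G _ =>
      (isOpen_lt (hc _) continuous_const).inter (isOpen_lt continuous_const (hc _))
    obtain ⟨q, hqN, T, hT, hqT⟩ :=
      mem_closure_iff.1 hp N hN (Set.mem_iInter₂.2 fun G _ => ⟨hy G, hz G⟩)
    have hval : ∀ G ⊆ S, (y G).1 (T v₀) < α ∧ β < (z G).1 (T v₀) := fun G hG => by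
      rw [← hqT, ← hqT]
      exact Set.mem_iInter₂.1 hqN G hG
    have hnew : insert (T v₀) S ∈ 𝓕 := by
      intro F hF hFfin
      refine ⟨IsIndependentOn.mono (fun G => ?_) hF, fun v hv => ?_⟩
      · have hmem : ∀ v ∈ S, (v ∈ G ↔ v ∈ G ∩ S) := fun v hv => by simp [hv]
        have hG := hval (G ∩ S) Set.inter_subset_right
        by_cases hTG : T v₀ ∈ G
        · refine ⟨z (G ∩ S), hzB _, fun v hv => ?_⟩
          rcases hv with rfl | hv
          · exact ⟨fun _ => hG.2, fun h => absurd hTG h⟩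
          · rw [hmem v hv]
            exact (hyz (G ∩ S) v hv).2
        · refine ⟨y (G ∩ S), hyB _, fun v hv => ?_⟩
          rcases hv with rfl | hv
          · exact ⟨fun h => absurd h hTG, fun _ => hG.1⟩
          · rw [hmem v hv]
            exact (hyz (G ∩ S) v hv).1
      · rcases hF hv with rfl | hv
        · simpa using T.le_of_opNorm_le hT v₀
        · exact (hS.prop {v} (by simpa using hv) (Set.finite_singleton v)).2 v rfl
    have hTS : T v₀ ∈ S := hS.le_of_ge hnew (Set.subset_insert _ _) (Set.mem_insert _ _)
    have h1 := ((hyz S _ hTS).1.1 hTS).trans (hval S subset_rfl).1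
    exact lt_asymm h1 hαβ
  exact hV (containsL1Copy_of_isIndependentOn hαβ hSinf
    (fun v hv => (hS.prop {v} (by simpa using hv) (Set.finite_singleton v)).2 v rfl)
    fun F hF hfin => (hS.prop F hF hfin).1)

/-- A copy of `ℓ¹` in `V` provides vectors `v n` in the unit ball at which functionals in the
dual ball realise every sequence of `[-1, 1]`, up to a fixed scale. -/
theorem ContainsL1Copy.exists_interpolating (hV : ContainsL1Copy V) :
    ∃ (v : ℕ → V) (d : ℝ), 0 < d ∧ (∀ n, ‖v n‖ ≤ 1) ∧
      ∀ s : ℕ → ℝ, (∀ n, |s n| ≤ 1) → ∃ φ : StrongDual ℝ V, ‖φ‖ ≤ 1 ∧ ∀ n, φ (v n) = d * s n := by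
  obtain ⟨f, c, hc, hf⟩ := hV
  let R : ℝ := ‖f‖ + 1
  have hRpos : 0 < R := by positivity
  let v : ℕ → V := fun n => R⁻¹ • f (lp.single 1 n 1)
  have hv : ∀ n, ‖v n‖ ≤ 1 := fun n => by
    have h := f.le_opNorm (lp.single 1 n (1 : ℝ))
    rw [lp.norm_single (by simp), norm_one, mul_one] at h
    rw [norm_smul, norm_inv, Real.norm_of_nonneg hRpos.le, inv_mul_le_iff₀ hRpos]
    simp only [R]
    linarith
  let d : ℝ := c / R
  have hd : 0 < d := by positivity
  let L : (ℕ →₀ ℝ) →ₗ[ℝ] V := Finsupp.linearCombination ℝ v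
  have hL : ∀ a : ℕ →₀ ℝ, d * ∑ i ∈ a.support, |a i| ≤ ‖L a‖ := fun a => by
    have h1 := hf (∑ i ∈ a.support, lp.single 1 i (a i))
    have h2 : ‖∑ i ∈ a.support, lp.single (E := fun _ : ℕ => ℝ) 1 i (a i)‖ =
        ∑ i ∈ a.support, |a i| := by
      simpa using lp.norm_sum_single (E := fun _ : ℕ => ℝ) (p := 1) (by simp) a a.support
    have h3 : L a = R⁻¹ • f (∑ i ∈ a.support, lp.single 1 i (a i)) := by
      simp only [L, Finsupp.linearCombination_apply, Finsupp.sum, map_sum, Finset.smul_sum, v]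
      refine Finset.sum_congr rfl fun i _ => ?_
      rw [smul_comm, ← map_smul, ← lp.single_smul, smul_eq_mul, mul_one]
    rw [h2] at h1
    rw [h3, norm_smul, norm_inv, Real.norm_of_nonneg hRpos.le, div_mul_eq_mul_div,
      div_eq_inv_mul]
    gcongr
  have hinj : Function.Injective L := by
    refine (injective_iff_map_eq_zero L).2 fun a ha => ?_
    have h := hL a
    rw [ha, norm_zero] at h
    have h0 : ∑ i ∈ a.support, |a i| = 0 :=
      le_antisymm (by nlinarith) (Finset.sum_nonneg fun _ _ => abs_nonneg _)
    ext i
    by_cases hi : i ∈ a.support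
    · exact abs_eq_zero.1 ((Finset.sum_eq_zero_iff_of_nonneg fun _ _ => abs_nonneg _).1 h0 i hi)
    · exact Finsupp.notMem_support_iff.1 hi
  refine ⟨v, d, hd, hv, fun s hs => ?_⟩
  let e : (ℕ →₀ ℝ) ≃ₗ[ℝ] LinearMap.range L := LinearEquiv.ofInjective L hinj
  let g : LinearMap.range L →ₗ[ℝ] ℝ :=
    (Finsupp.linearCombination ℝ fun n => d * s n).comp e.symm.toLinearMap
  have hg : ∀ x, ‖g x‖ ≤ 1 * ‖x‖ := fun x => by
    obtain ⟨a, rfl⟩ := e.surjective x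
    have h1 : g (e a) = ∑ i ∈ a.support, a i * (d * s i) := by
      simp [g, Finsupp.linearCombination_apply, Finsupp.sum]
    have h2 : ‖e a‖ = ‖L a‖ := rfl
    rw [h1, h2, one_mul]
    refine le_trans ?_ (hL a)
    rw [Finset.mul_sum]
    refine norm_sum_le_of_le _ fun i _ => ?_
    rw [Real.norm_eq_abs, abs_mul, abs_mul, abs_of_pos hd]
    calc |a i| * (d * |s i|) ≤ |a i| * (d * 1) := by gcongr; exact hs i
      _ = d * |a i| := by ring
  obtain ⟨φ, hφ, hnorm⟩ := exists_extension_norm_eq _ (g.mkContinuous 1 hg)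
  refine ⟨φ, hnorm.trans_le (g.mkContinuous_norm_le zero_le_one hg), fun n => ?_⟩
  have h1 : ((e (Finsupp.single n 1) : LinearMap.range L) : V) = v n := by
    simp [e, L]
  rw [← h1, hφ]
  simp [g]

theorem norm_smulRight_le_one {φ : StrongDual ℝ V} {v : V} (hφ : ‖φ‖ ≤ 1) (hv : ‖v‖ ≤ 1) :
    ‖φ.smulRight v‖ ≤ 1 := by
  rw [ContinuousLinearMap.norm_smulRight_apply]
  exact mul_le_one₀ hφ (norm_nonneg _) hv

/-- If the values of a continuous `x : X → (ℕ → ℝ)` on a compact space include all sequences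
of signs `±d`, the limit of the coordinates along a free ultrafilter is not fragmented. -/
theorem not_realFragmented_of_sign_sequences.{u} {X : Type u} [TopologicalSpace X] [CompactSpace X]
    {x : X → ℕ → ℝ} (hx : Continuous x) {d : ℝ} (hd : 0 < d)
    (hsurj : ∀ s : ℕ → ℝ, (∀ n, s n = d ∨ s n = -d) → ∃ q, x q = s) {h : X → ℝ} {κ : ℝ}
    (hκ : 0 < κ)
    (hh : ∀ q t, (∀ᶠ n in Filter.atTop, x q n = t) → h q = t * κ) : ¬ RealFragmented h := by
  let C : Set (ℕ → ℝ) := {s | ∀ n, s n = d ∨ s n = -d}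
  have hC : IsClosed C := by
    have : C = ⋂ n, (fun s : ℕ → ℝ => s n) ⁻¹' {d, -d} := by
      ext s
      simp [C]
    rw [this]
    exact isClosed_iInter fun n => (Set.toFinite _).isClosed.preimage (continuous_apply n)
  let K : Set X := x ⁻¹' C
  have : CompactSpace K := isCompact_iff_compactSpace.1 (hC.preimage hx).isCompact
  let π : K → ULift.{u} C := fun q => ⟨⟨x q, q.2⟩⟩
  have hπ : Continuous π :=
    continuous_uliftUp.comp ((hx.comp continuous_subtype_val).subtype_mk _)
  have hπsurj : Function.Surjective π := fun s =>
    let ⟨q, hq⟩ := hsurj s.down s.down.2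
    ⟨⟨q, show x q ∈ C from hq ▸ s.down.2⟩, ULift.ext _ _ (Subtype.ext hq)⟩
  obtain ⟨E, hE, hEimg, hEmin⟩ := exists_compact_surjective_zorn_subset hπ hπsurj
  intro hfrag
  have hEne : E.Nonempty := by
    have : (π '' E).Nonempty := hEimg ▸ ⟨⟨⟨fun _ => d, fun _ => Or.inl rfl⟩⟩, trivial⟩
    exact this.of_image
  obtain ⟨O, hO, ⟨_, hq₀O, q₀, hq₀E, rfl⟩, hosc⟩ :=
    hfrag (Subtype.val '' E) (hEne.image _) (2 * d * κ) (by positivity)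
  let E₀ : Set E := {q | (q : X) ∉ O}
  have hE₀ : IsClosed E₀ :=
    hO.isClosed_compl.preimage (continuous_subtype_val.comp continuous_subtype_val)
  have hne : E₀ ≠ Set.univ := fun h => by
    have : (⟨q₀, hq₀E⟩ : E) ∈ E₀ := h ▸ trivial
    exact this hq₀O
  have hclosed : IsClosed (E.domRestrict π '' E₀) :=
    (hE₀.isCompact.image (hπ.comp continuous_subtype_val)).isClosed
  obtain ⟨⟨s⟩, hs⟩ := (Set.ne_univ_iff_exists_notMem _).1 (hEmin E₀ hne hE₀)
  have key : ∀ t, t = d ∨ t = -d → ∃ q ∈ O ∩ Subtype.val '' E, h q = t * κ := by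
    intro t ht
    let u : ℕ → C := fun N =>
      ⟨fun n => if n < N then s.1 n else t, fun n => by
        dsimp only
        split_ifs
        exacts [s.2 n, ht]⟩
    have hu : Filter.Tendsto u Filter.atTop (𝓝 s) := by
      refine tendsto_subtype_rng.2 (tendsto_pi_nhds.2 fun n => ?_)
      refine tendsto_const_nhds.congr' ?_
      filter_upwards [Filter.eventually_gt_atTop n] with N hN
      simp [u, hN]
    obtain ⟨N, hN⟩ := (((continuous_uliftUp.tendsto s).comp hu).eventually
      (hclosed.isOpen_compl.mem_nhds hs)).exists
    obtain ⟨q, hqE, hq⟩ : ULift.up (u N) ∈ π '' E := hEimg ▸ trivial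
    have hqO : (q : X) ∈ O := by
      by_contra hqO
      exact hN ⟨⟨q, hqE⟩, hqO, hq⟩
    refine ⟨q, ⟨hqO, q, hqE, rfl⟩, hh q t ?_⟩
    filter_upwards [Filter.eventually_ge_atTop N] with n hn
    have : x q = (u N).1 := congrArg (fun z => z.down.1) hq
    simp [this, u, hn.not_gt]
  obtain ⟨q, hq, hqd⟩ := key d (Or.inl rfl)
  obtain ⟨r, hr, hrd⟩ := key (-d) (Or.inr rfl)
  have hlt := (le_abs_self _).trans_lt (hosc q hq r hr)
  rw [hqd, hrd] at hlt
  linarith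

/-- If `V` contains a copy of `ℓ¹`, some left translation of `E(V)` is not fragmented. -/
theorem EnvSemigroup.exists_not_isFragmentedMap (hV : ContainsL1Copy V) :
    ∃ p : EnvSemigroup V, ∀ f : EnvSemigroup V → EnvSemigroup V,
      (∀ q, (f q : DualBall V → DualBall V) = p.1 ∘ q.1) → ¬ IsFragmentedMap f := by
  obtain ⟨v, d, hd, hv, hinterp⟩ := hV.exists_interpolating
  obtain ⟨φ, hφ, hφv⟩ := hinterp (fun _ => 1) (by simp)
  simp only [mul_one] at hφv
  let ψ₀ : DualBall V := DualBall.mk φ hφ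
  let T : ℕ → EnvSemigroup V := fun n => ⟨_, adjMap_mem _ (norm_smulRight_le_one hφ (hv n))⟩
  obtain ⟨p, hp⟩ : ∃ p, Filter.Tendsto T (Filter.hyperfilter ℕ : Filter ℕ) (𝓝 p) := by
    obtain ⟨p, -, hp⟩ := isCompact_univ.ultrafilter_le_nhds
      ((Filter.hyperfilter ℕ).map T) (by simp)
    exact ⟨p, hp⟩
  refine ⟨p, fun f hf hfrag => ?_⟩
  have hlim : ∀ ψ : DualBall V, Filter.Tendsto (fun n => ψ.1 (v n) * d)
      (Filter.hyperfilter ℕ : Filter ℕ) (𝓝 ((p.1 ψ).1 (v 0))) := fun ψ => by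
    have h := ((EnvSemigroup.continuous_eval_s5 ψ (v 0)).tendsto p).comp hp
    refine h.congr fun n => ?_
    simp [T, adjMap_apply, hφv, mul_comm]
  have hreal := hfrag.realFragmented (EnvSemigroup.continuous_eval_s5 ψ₀ (v 0))
  simp only [hf] at hreal
  refine not_realFragmented_of_sign_sequences
    (x := fun (q : EnvSemigroup V) n => (q.1 ψ₀).1 (v n)) (d := d * d) (κ := d)
    (continuous_pi fun n => EnvSemigroup.continuous_eval_s5 ψ₀ (v n)) (by positivity) ?_ hd ?_ hreal
  · intro s hs
    obtain ⟨χ, hχ, hχv⟩ := hinterp (fun n => s n / (d * d)) fun n => by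
      rcases hs n with h | h <;> simp [h, hd.ne']
    refine ⟨⟨_, adjMap_mem _ (norm_smulRight_le_one hχ (hv 0))⟩, funext fun n => ?_⟩
    have : ψ₀.1 (v 0) = d := hφv 0
    simp [adjMap_apply, hχv, this]
    field_simp
  · intro q t hq
    refine tendsto_nhds_unique (hlim (q.1 ψ₀)) ((tendsto_const_nhds (x := t * d)).congr' ?_)
    have hle : (Filter.hyperfilter ℕ : Filter ℕ) ≤ Filter.atTop :=
      Nat.cofinite_eq_atTop ▸ Filter.hyperfilter_le_cofinite
    filter_upwards [hle hq] with n hn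
    rw [hn]

end

/-- `V` is Rosenthal (contains no copy of `ℓ¹`) iff every `p ∈ E(V)` is a
fragmented self-map of `B*` iff every left translation of `E(V)` is a fragmented self-map
of `E(V)` (i.e. `E(V)` is a tame semigroup). -/
theorem stmt5 (V : Type*) [NormedAddCommGroup V] [NormedSpace ℝ V] [CompleteSpace V] :
    List.TFAE
      [¬ ContainsL1Copy V,
       ∀ p ∈ EnvSemigroup V, IsFragmentedMap p,
       ∀ p ∈ EnvSemigroup V, ∀ f : EnvSemigroup V → EnvSemigroup V,
         (∀ q : EnvSemigroup V,
           (f q : DualBall V → DualBall V) = p ∘ (q : DualBall V → DualBall V)) →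
         IsFragmentedMap f] := by
  tfae_have 1 → 2 := fun hV p hp => EnvSemigroup.isFragmentedMap hV hp
  tfae_have 2 → 3 := fun h p hp f hf => EnvSemigroup.isFragmentedMap_leftTranslation (h p hp) f hf
  tfae_have 3 → 1 := fun h hV =>
    let ⟨p, hp⟩ := EnvSemigroup.exists_not_isFragmentedMap hV
    let f : EnvSemigroup V → EnvSemigroup V := fun q => ⟨p.1 ∘ q.1, EnvSemigroup.comp_mem_s5 p.2 q.2⟩
    hp f (fun _ => rfl) (h p.1 p.2 f fun _ => rfl)
  tfae_finish
end

section
/- (BFT dichotomy for Banach spaces) Let V be a separable real Banach space. If V contains no isomorphic copy of ℓ¹, then the cardinality of the enveloping semigroup E(V) is at most 2^{ℵ₀}. If V contains an isomorphic copy of ℓ¹, then E(V) contains a homeomorphic copy of βℕ, the Stone–Čech compactification of the discrete natural numbers (so in particular the cardinality of E(V) equals 2^{2^{ℵ₀}}). -/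
open scoped Topology

/-! ### Separating the sublevel and superlevel sets of a function by a Borel set -/

/-- A function on a second countable space which, on every nonempty closed set `K`, fails to
be simultaneously `< a` and `> b` on dense subsets of `K` has Borel separated level sets. -/
theorem exists_measurableSet_separating {X : Type*} [TopologicalSpace X]
    [SecondCountableTopology X] (f : X → ℝ) (a b : ℝ)
    (h : ∀ K : Set X, IsClosed K → K.Nonempty → ∃ U : Set X, IsOpen U ∧ (U ∩ K).Nonempty ∧
      ((∀ x ∈ U ∩ K, a ≤ f x) ∨ (∀ x ∈ U ∩ K, f x ≤ b))) :
    ∃ D : Set X, @MeasurableSet X (borel X) D ∧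
      ∀ x, (f x < a → x ∈ D) ∧ (b < f x → x ∉ D) := by
  let _ : MeasurableSpace X := borel X
  have _ : BorelSpace X := ⟨rfl⟩
  let Good : Set X → Prop := fun U => ∃ D : Set X, MeasurableSet D ∧
    ∀ x ∈ U, (f x < a → x ∈ D) ∧ (b < f x → x ∉ D)
  let B := {U ∈ TopologicalSpace.countableBasis X | Good U}
  have hBc : B.Countable := (TopologicalSpace.countable_countableBasis X).mono fun _ hU => hU.1
  have hBo : ∀ U ∈ B, IsOpen U := fun U hU => TopologicalSpace.isOpen_of_mem_countableBasis hU.1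
  let W : Set X := ⋃₀ B
  have hWo : IsOpen W := isOpen_sUnion hBo
  have hW : Good W := by
    rcases B.eq_empty_or_nonempty with hB | hB
    · exact ⟨∅, MeasurableSet.empty, fun x hx => by simp [W, hB] at hx⟩
    · obtain ⟨u, hu⟩ := hBc.exists_eq_range hB
      have hg : ∀ n, u n ∈ B := fun n => hu ▸ Set.mem_range_self n
      choose D hDm hD using fun n => (hg n).2
      refine ⟨⋃ n, D n ∩ disjointed u n, MeasurableSet.iUnion fun n => (hDm n).inter
        (MeasurableSet.disjointed (fun i => (hBo _ (hg i)).measurableSet) n), fun x hx => ?_⟩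
      have hx' : x ∈ ⋃ n, disjointed u n := by
        rw [iUnion_disjointed, ← Set.sUnion_range, ← hu]; exact hx
      obtain ⟨n, hn⟩ := Set.mem_iUnion.1 hx'
      refine ⟨fun hfx => Set.mem_iUnion.2 ⟨n, (hD n x (disjointed_subset u n hn)).1 hfx, hn⟩,
        fun hfx hmem => ?_⟩
      obtain ⟨m, hm, hm'⟩ := Set.mem_iUnion.1 hmem
      exact (hD m x (disjointed_subset u m hm')).2 hfx hm
  have hWuniv : W = Set.univ := by
    by_contra hne
    obtain ⟨U, hUo, ⟨y, hyU, hyW⟩, hU⟩ := h Wᶜ hWo.isClosed_compl (Set.nonempty_compl.2 hne)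
    have hUgood : Good U := by
      obtain ⟨D, hDm, hD⟩ := hW
      rcases hU with hU | hU
      · refine ⟨D ∩ W, hDm.inter hWo.measurableSet, fun x hx => ⟨fun hfx => ?_, fun hfx hxD =>
          (hD x hxD.2).2 hfx hxD.1⟩⟩
        by_cases hxW : x ∈ W
        · exact ⟨(hD x hxW).1 hfx, hxW⟩
        · exact absurd (hU x ⟨hx, hxW⟩) (not_le.2 hfx)
      · refine ⟨D ∪ Wᶜ, hDm.union hWo.measurableSet.compl, fun x hx => ?_⟩
        by_cases hxW : x ∈ W
        · simpa [hxW] using hD x hxW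
        · exact ⟨fun _ => Or.inr hxW, fun hfx => absurd (hU x ⟨hx, hxW⟩) (not_le.2 hfx)⟩
    obtain ⟨U', hU', hyU', hsub⟩ :=
      (TopologicalSpace.isBasis_countableBasis X).exists_subset_of_mem_open hyU hUo
    obtain ⟨D, hDm, hD⟩ := hUgood
    exact hyW ⟨U', ⟨hU', D, hDm, fun x hx => hD x (hsub hx)⟩, hyU'⟩
  obtain ⟨D, hDm, hD⟩ := hW
  exact ⟨D, hDm, fun x => hD x (hWuniv ▸ Set.mem_univ x)⟩

/-! ### Independent sequences -/

/-- If a pointwise limit `f` of continuous functions from `F` is `< a` and `> b` on dense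
subsets of a nonempty set `K`, then `F` contains an independent sequence. -/
theorem exists_independent_seq {X : Type*} [TopologicalSpace X] {F : Set (X → ℝ)}
    (hF : ∀ g ∈ F, Continuous g) {f : X → ℝ} (hf : f ∈ closure F) {a b : ℝ}
    {K : Set X} (hK : K.Nonempty)
    (h : ∀ U : Set X, IsOpen U → (U ∩ K).Nonempty →
      (∃ x ∈ U ∩ K, f x < a) ∧ (∃ x ∈ U ∩ K, b < f x)) :
    ∃ g : ℕ → X → ℝ, (∀ n, g n ∈ F) ∧
      ∀ (s : ℕ → Prop) (n : ℕ), ∃ x, ∀ i < n, (s i → b < g i x) ∧ (¬ s i → g i x < a) := by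
  let S := {𝒰 : Set (Set X) // 𝒰.Finite ∧ ∀ U ∈ 𝒰, IsOpen U ∧ (U ∩ K).Nonempty}
  have step : ∀ 𝒰 : S, ∃ g ∈ F, ∀ U ∈ 𝒰.1,
      ((U ∩ {x | g x < a}) ∩ K).Nonempty ∧ ((U ∩ {x | b < g x}) ∩ K).Nonempty := by
    rintro ⟨𝒰, hfin, h𝒰⟩
    have _ : Nonempty X := ⟨hK.some⟩
    choose! x hx hfx using fun U (hU : U ∈ 𝒰) => (h U (h𝒰 U hU).1 (h𝒰 U hU).2).1
    choose! y hy hfy using fun U (hU : U ∈ 𝒰) => (h U (h𝒰 U hU).1 (h𝒰 U hU).2).2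
    have hopen : IsOpen (⋂ U ∈ 𝒰, {g : X → ℝ | g (x U) < a ∧ b < g (y U)}) :=
      hfin.isOpen_biInter fun U _ =>
        (isOpen_lt (continuous_apply _) continuous_const).inter
          (isOpen_lt continuous_const (continuous_apply _))
    obtain ⟨g, hg, hgF⟩ := mem_closure_iff.1 hf _ hopen
      (Set.mem_iInter₂.2 fun U hU => ⟨hfx U hU, hfy U hU⟩)
    refine ⟨g, hgF, fun U hU => ?_⟩
    have hgU := Set.mem_iInter₂.1 hg U hU
    exact ⟨⟨x U, ⟨(hx U hU).1, hgU.1⟩, (hx U hU).2⟩, ⟨y U, ⟨(hy U hU).1, hgU.2⟩, (hy U hU).2⟩⟩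
  choose g hgF hg using step
  let next : S → S := fun 𝒰 =>
    ⟨(fun U => U ∩ {x | g 𝒰 x < a}) '' 𝒰.1 ∪ (fun U => U ∩ {x | b < g 𝒰 x}) '' 𝒰.1,
      (𝒰.2.1.image _).union (𝒰.2.1.image _), by
        rintro _ (⟨U, hU, rfl⟩ | ⟨U, hU, rfl⟩)
        · exact ⟨(𝒰.2.2 U hU).1.inter (isOpen_lt (hF _ (hgF 𝒰)) continuous_const),
            (hg 𝒰 U hU).1⟩
        · exact ⟨(𝒰.2.2 U hU).1.inter (isOpen_lt continuous_const (hF _ (hgF 𝒰))),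
            (hg 𝒰 U hU).2⟩⟩
  let start : S := ⟨{Set.univ}, Set.finite_singleton _, by
    rintro _ rfl; exact ⟨isOpen_univ, by simpa using hK⟩⟩
  let seq : ℕ → S := fun n => next^[n] start
  have hseq : ∀ n, seq (n + 1) = next (seq n) := fun n => Function.iterate_succ_apply' next n start
  refine ⟨fun n => g (seq n), fun n => hgF _, fun s n => ?_⟩
  have key : ∀ n, ∃ U ∈ (seq n).1, ∀ i < n, ∀ x ∈ U,
      (s i → b < g (seq i) x) ∧ (¬ s i → g (seq i) x < a) := by
    intro n
    induction n with
    | zero => exact ⟨Set.univ, rfl, fun i hi => absurd hi (Nat.not_lt_zero i)⟩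
    | succ n ih =>
      obtain ⟨U, hU, hi⟩ := ih
      by_cases hs : s n
      · refine ⟨U ∩ {x | b < g (seq n) x}, ?_, fun i hin x hx => ?_⟩
        · rw [hseq]; exact Or.inr ⟨U, hU, rfl⟩
        · rcases Nat.lt_succ_iff_lt_or_eq.1 hin with hin | rfl
          · exact hi i hin x hx.1
          · exact ⟨fun _ => hx.2, fun hns => absurd hs hns⟩
      · refine ⟨U ∩ {x | g (seq n) x < a}, ?_, fun i hin x hx => ?_⟩
        · rw [hseq]; exact Or.inl ⟨U, hU, rfl⟩
        · rcases Nat.lt_succ_iff_lt_or_eq.1 hin with hin | rfl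
          · exact hi i hin x hx.1
          · exact ⟨fun hs' => absurd hs' hs, fun _ => hx.2⟩
  obtain ⟨U, hU, hi⟩ := key n
  obtain ⟨x, hx, -⟩ := ((seq n).2.2 U hU).2
  exact ⟨x, fun i hin => hi i hin x hx⟩

/-! ### The space `ℓ¹` -/

theorem lp_one_hasSum_norm (x : lp (fun _ : ℕ => ℝ) 1) : HasSum (fun i => ‖x i‖) ‖x‖ := by
  simpa using lp.hasSum_norm (p := 1) (by simp) x

/-- The operator `ℓ¹ → V` sending the unit vectors to a bounded sequence `v`. -/
theorem exists_l1_map {V : Type*} [NormedAddCommGroup V] [NormedSpace ℝ V] [CompleteSpace V]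
    (v : ℕ → V) (R : ℝ) (hv : ∀ n, ‖v n‖ ≤ R) :
    ∃ f : lp (fun _ : ℕ => ℝ) 1 →L[ℝ] V, ∀ x, HasSum (fun i => x i • v i) (f x) := by
  have hb : ∀ (x : lp (fun _ : ℕ => ℝ) 1) i, ‖x i • v i‖ ≤ R * ‖x i‖ := fun x i => by
    rw [norm_smul, mul_comm]; exact mul_le_mul_of_nonneg_right (hv i) (norm_nonneg _)
  have hs : ∀ x : lp (fun _ : ℕ => ℝ) 1, Summable fun i => x i • v i := fun x =>
    Summable.of_norm_bounded ((lp_one_hasSum_norm x).summable.mul_left R) (hb x)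
  let f : lp (fun _ : ℕ => ℝ) 1 →ₗ[ℝ] V :=
    { toFun := fun x => ∑' i, x i • v i
      map_add' := fun x y => by
        rw [← (hs x).tsum_add (hs y)]; simp [add_smul]
      map_smul' := fun c x => by
        simp only [lp.coeFn_smul, Pi.smul_apply, smul_eq_mul, RingHom.id_apply, mul_smul]
        exact (hs x).tsum_const_smul c }
  exact ⟨f.mkContinuous R fun x =>
    tsum_of_norm_bounded ((lp_one_hasSum_norm x).mul_left R) (hb x), fun x => (hs x).hasSum⟩

theorem containsL1Copy_of_independent {V : Type*} [NormedAddCommGroup V] [NormedSpace ℝ V]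
    [CompleteSpace V] (v : ℕ → V) (R : ℝ) (hv : ∀ n, ‖v n‖ ≤ R) {a b : ℝ} (hab : a < b)
    (hind : ∀ (s : ℕ → Prop) (n : ℕ), ∃ ψ : DualBall V,
      ∀ i < n, (s i → b < ψ.1 (v i)) ∧ (¬ s i → ψ.1 (v i) < a)) :
    ContainsL1Copy V := by
  obtain ⟨f, hf⟩ := exists_l1_map v R hv
  refine ⟨f, (b - a) / 2, by linarith, fun x => ?_⟩
  refine le_of_tendsto_of_tendsto' ((lp_one_hasSum_norm x).tendsto_sum_nat.const_mul _)
    (hf x).tendsto_sum_nat.norm fun n => ?_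
  obtain ⟨ψ, hψ⟩ := hind (fun i => 0 ≤ x i) n
  obtain ⟨χ, hχ⟩ := hind (fun i => ¬ 0 ≤ x i) n
  have h1 : (b - a) * ∑ i ∈ Finset.range n, ‖x i‖ ≤
      ψ.1 (∑ i ∈ Finset.range n, x i • v i) - χ.1 (∑ i ∈ Finset.range n, x i • v i) := by
    simp only [map_sum, map_smul, smul_eq_mul]
    rw [← Finset.sum_sub_distrib, Finset.mul_sum]
    refine Finset.sum_le_sum fun i hi => ?_
    have hψi := hψ i (Finset.mem_range.1 hi)
    have hχi := hχ i (Finset.mem_range.1 hi)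
    rw [Real.norm_eq_abs]
    by_cases h0 : 0 ≤ x i
    · have h2 := hψi.1 h0
      have h3 := hχi.2 (not_not.2 h0)
      rw [abs_of_nonneg h0]; nlinarith
    · have h2 := hψi.2 h0
      have h3 := hχi.1 h0
      rw [abs_of_neg (not_le.1 h0)]; nlinarith
  have h2 := abs_le.1 (ψ.2 (∑ i ∈ Finset.range n, x i • v i))
  have h3 := abs_le.1 (χ.2 (∑ i ∈ Finset.range n, x i • v i))
  linarith [h2.2, h3.1]

/-! ### The dual ball of a separable space -/

instance dualBall_compactSpace (V : Type*) [NormedAddCommGroup V] [NormedSpace ℝ V] :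
    CompactSpace (DualBall V) := by
  have : {ψ : WeakDual ℝ V | ∀ v : V, |ψ v| ≤ ‖v‖} =
      WeakDual.toStrongDual ⁻¹' Metric.closedBall 0 1 := by
    ext ψ
    simp only [Set.mem_ofPred_eq, Set.mem_preimage, mem_closedBall_zero_iff]
    constructor
    · exact fun h => ContinuousLinearMap.opNorm_le_bound _ zero_le_one fun v => by
        rw [one_mul]; exact h v
    · exact fun h v => by simpa using (WeakDual.toStrongDual ψ).le_of_opNorm_le h v
  have hc := WeakDual.isCompact_closedBall (𝕜 := ℝ) (E := V) 0 1
  rw [← this] at hc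
  exact isCompact_iff_compactSpace.1 hc

theorem dualBall_continuous_eval {V : Type*} [NormedAddCommGroup V] [NormedSpace ℝ V] (v : V) :
    Continuous fun ψ : DualBall V => ψ.1 v :=
  (WeakDual.eval_continuous v).comp continuous_subtype_val

instance dualBall_secondCountable (V : Type*) [NormedAddCommGroup V] [NormedSpace ℝ V]
    [TopologicalSpace.SeparableSpace V] : SecondCountableTopology (DualBall V) := by
  have _ : TopologicalSpace.MetrizableSpace (DualBall V) :=
    WeakDual.metrizable_of_isCompact ℝ V _ (isCompact_iff_compactSpace.2 (dualBall_compactSpace V))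
  let _ := TopologicalSpace.metrizableSpaceMetric (DualBall V)
  infer_instance

theorem dualBall_ext_denseSeq {V : Type*} [NormedAddCommGroup V] [NormedSpace ℝ V]
    [TopologicalSpace.SeparableSpace V] {ψ χ : DualBall V}
    (h : ∀ n, ψ.1 (TopologicalSpace.denseSeq V n) = χ.1 (TopologicalSpace.denseSeq V n)) :
    ψ = χ :=
  Subtype.ext <| DFunLike.ext'_iff.mpr <| (map_continuous ψ.1).ext_on
    (TopologicalSpace.denseRange_denseSeq V) (map_continuous χ.1)
    (Set.eqOn_range.mpr (funext h))

/-! ### Cardinality bounds -/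

open Cardinal in
theorem mk_le_continuum_of_injective {α ι β : Type*} [Countable ι] (hβ : #β ≤ 𝔠)
    (f : α → ι → β) (hf : Function.Injective f) : #α ≤ 𝔠 := by
  have h := lift_mk_le_lift_mk_of_injective hf
  rw [mk_arrow] at h
  rw [← lift_le_continuum]
  refine h.trans (lift_le_continuum.2 ?_)
  calc _ ≤ (𝔠 : Cardinal) ^ lift #ι := power_le_power_right (lift_le_continuum.2 hβ)
    _ ≤ 𝔠 ^ ℵ₀ := power_le_power_left continuum_ne_zero
        (lift_le_aleph0.2 (mk_le_aleph0_iff.2 inferInstance))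
    _ = 𝔠 := continuum_power_aleph0

open Cardinal in
theorem mk_dualBall_le (V : Type*) [NormedAddCommGroup V] [NormedSpace ℝ V]
    [TopologicalSpace.SeparableSpace V] : #(DualBall V) ≤ 𝔠 :=
  mk_le_continuum_of_injective mk_real.le
    (fun (ψ : DualBall V) (n : ℕ) => ψ.1 (TopologicalSpace.denseSeq V n))
    fun _ _ h => dualBall_ext_denseSeq (congrFun h)

open Cardinal in
theorem mk_measurableSet_borel_le (X : Type*) [TopologicalSpace X] [SecondCountableTopology X] :
    #{D : Set X // @MeasurableSet X (borel X) D} ≤ 𝔠 := by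
  rw [(TopologicalSpace.isBasis_countableBasis X).borel_eq_generateFrom]
  exact MeasurableSpace.cardinal_measurableSet_le_continuum
    (((TopologicalSpace.countable_countableBasis X).le_aleph0).trans aleph0_le_continuum)

/-- The coordinates of an element of the enveloping semigroup are pointwise limits of
evaluations at vectors of bounded norm. -/
theorem eval_mem_closure {V : Type*} [NormedAddCommGroup V] [NormedSpace ℝ V]
    {p : DualBall V → DualBall V} (hp : p ∈ EnvSemigroup V) (v : V) :
    (fun ψ => (p ψ).1 v) ∈
      closure {g : DualBall V → ℝ | ∃ w : V, ‖w‖ ≤ ‖v‖ ∧ g = fun ψ => ψ.1 w} := by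
  have hcont : Continuous fun (q : DualBall V → DualBall V) (ψ : DualBall V) => (q ψ).1 v :=
    continuous_pi fun ψ => (dualBall_continuous_eval v).comp (continuous_apply ψ)
  refine map_mem_closure hcont hp fun q hq => ?_
  obtain ⟨T, hT, hq⟩ := hq
  exact ⟨T v, by simpa using T.le_of_opNorm_le hT v, funext fun ψ => hq ψ v⟩

theorem exists_measurableSet_separating_of_not_containsL1Copy {V : Type*} [NormedAddCommGroup V]
    [NormedSpace ℝ V] [CompleteSpace V] [TopologicalSpace.SeparableSpace V]
    (hV : ¬ ContainsL1Copy V) {R : ℝ} {f : DualBall V → ℝ}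
    (hf : f ∈ closure {g : DualBall V → ℝ | ∃ w : V, ‖w‖ ≤ R ∧ g = fun ψ => ψ.1 w})
    {a b : ℝ} (hab : a < b) :
    ∃ D : Set (DualBall V), @MeasurableSet _ (borel (DualBall V)) D ∧
      ∀ x, (f x < a → x ∈ D) ∧ (b < f x → x ∉ D) := by
  refine exists_measurableSet_separating f a b ?_
  by_contra! h
  obtain ⟨K, -, hK, h⟩ := h
  have hF : ∀ g ∈ {g : DualBall V → ℝ | ∃ w : V, ‖w‖ ≤ R ∧ g = fun ψ => ψ.1 w},
      Continuous g := by
    rintro _ ⟨w, -, rfl⟩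
    exact dualBall_continuous_eval w
  obtain ⟨g, hgF, hg⟩ := exists_independent_seq hF hf hK h
  choose v hv hgv using hgF
  exact hV (containsL1Copy_of_independent v R hv hab fun s n => by simpa only [hgv] using hg s n)

open Cardinal in
theorem mk_envSemigroup_le {V : Type*} [NormedAddCommGroup V] [NormedSpace ℝ V]
    [CompleteSpace V] [TopologicalSpace.SeparableSpace V] (hV : ¬ ContainsL1Copy V) :
    #(EnvSemigroup V) ≤ 𝔠 := by
  choose D hDm hD using fun (p : EnvSemigroup V) (i : ℕ × {q : ℚ × ℚ // q.1 < q.2}) =>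
    exists_measurableSet_separating_of_not_containsL1Copy hV
      (eval_mem_closure p.2 (TopologicalSpace.denseSeq V i.1)) (Rat.cast_lt (K := ℝ).2 i.2.2)
  refine mk_le_continuum_of_injective (mk_measurableSet_borel_le (DualBall V))
    (fun p i => ⟨D p i, hDm p i⟩) fun p q hpq => ?_
  have hDpq : ∀ i, D p i = D q i := fun i => congrArg Subtype.val (congrFun hpq i)
  refine Subtype.ext (funext fun ψ => dualBall_ext_denseSeq fun n => ?_)
  have aux : ∀ p q : EnvSemigroup V, (∀ i, D p i = D q i) →
      (q.1 ψ).1 (TopologicalSpace.denseSeq V n) ≤ (p.1 ψ).1 (TopologicalSpace.denseSeq V n) := by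
    intro p q hpq
    by_contra! hlt
    obtain ⟨s, hps, hs⟩ := exists_rat_btwn hlt
    obtain ⟨t, hst, htq⟩ := exists_rat_btwn hs
    let i : ℕ × {q : ℚ × ℚ // q.1 < q.2} := (n, ⟨(s, t), Rat.cast_lt.1 hst⟩)
    exact (hD q i ψ).2 htq (hpq i ▸ (hD p i ψ).1 hps)
  exact le_antisymm (aux q p fun i => (hDpq i).symm) (aux p q hDpq)

/-! ### The cardinality of `βℕ` -/

theorem countable_isClopen (X : Type*) [TopologicalSpace X] [CompactSpace X]
    [SecondCountableTopology X] [T2Space X] [TotallyDisconnectedSpace X] :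
    Countable {C : Set X // IsClopen C} := by
  have _ : Countable (TopologicalSpace.Clopens X) :=
    TopologicalSpace.Clopens.countable_iff_secondCountable.2 inferInstance
  exact Function.Injective.countable
    (f := fun C : {C : Set X // IsClopen C} => (⟨C.1, C.2⟩ : TopologicalSpace.Clopens X))
    fun C D h => Subtype.ext (congrArg (fun E : TopologicalSpace.Clopens X => E.carrier) h)

/-- The power of a two-point space with exponent the Cantor set is separable. -/
theorem exists_denseRange_nat_cantor :
    ∃ u : ℕ → ((ℕ → Bool) → Bool), DenseRange u := by
  classical
  have _ := countable_isClopen (ℕ → Bool)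
  have _ : Nonempty {C : Set (ℕ → Bool) // IsClopen C} := ⟨∅, isClopen_empty⟩
  obtain ⟨e, he⟩ := exists_surjective_nat {C : Set (ℕ → Bool) // IsClopen C}
  refine ⟨fun n x => decide (x ∈ (e n).1), dense_iff_inter_open.2 fun U hU ⟨h, hh⟩ => ?_⟩
  obtain ⟨I, N, hN, hsub⟩ := isOpen_pi_iff.1 hU h hh
  obtain ⟨C, hC, hZC, hCU⟩ := exists_clopen_of_closed_subset_open
    (Z := {x | x ∈ I ∧ h x = true}) (U := {x | x ∈ I ∧ h x = false}ᶜ)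
    (I.finite_toSet.subset fun x hx => hx.1).isClosed
    (I.finite_toSet.subset fun x (hx : x ∈ I ∧ h x = false) => hx.1).isClosed.isOpen_compl
    (fun x hx hx' => by simp [hx.2] at hx')
  obtain ⟨n, hn⟩ := he ⟨C, hC⟩
  refine ⟨_, hsub fun x hx => ?_, n, rfl⟩
  change decide (x ∈ (e n).1) ∈ N x
  suffices decide (x ∈ (e n).1) = h x from this ▸ (hN x hx).2
  rw [hn]
  by_cases hhx : h x = true
  · simpa [hhx] using hZC ⟨hx, hhx⟩
  · have hfx : h x = false := by simpa using hhx
    simpa [hfx] using fun hxC => hCU hxC ⟨hx, hfx⟩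

open Cardinal in
theorem two_power_continuum_le_mk_stoneCech : (2 : Cardinal) ^ 𝔠 ≤ #(StoneCech ℕ) := by
  obtain ⟨u, hu⟩ := exists_denseRange_nat_cantor
  have hc : Continuous (stoneCechExtend (continuous_of_discreteTopology (f := u))) :=
    continuous_stoneCechExtend _
  have hsurj : Function.Surjective
      (stoneCechExtend (continuous_of_discreteTopology (f := u))) := by
    have hd : DenseRange (stoneCechExtend (continuous_of_discreteTopology (f := u))) := by
      refine hu.mono ?_
      rintro _ ⟨n, rfl⟩
      exact ⟨stoneCechUnit n, stoneCechExtend_stoneCechUnit _ n⟩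
    rw [← Set.range_eq_univ, ← (isCompact_range hc).isClosed.closure_eq]
    exact hd.closure_range
  simpa [← two_power_aleph0] using mk_le_of_surjective hsurj

/-! ### Embedding `βℕ` into the enveloping semigroup -/

/-- The adjoint of the contraction `w ↦ φ w • e`. -/
noncomputable def rankOneAdj {V : Type*} [NormedAddCommGroup V] [NormedSpace ℝ V] (φ : DualBall V)
    (e : V) (he : ‖e‖ ≤ 1) (ψ : DualBall V) : DualBall V :=
  ⟨ψ.1 e • φ.1, fun v => by
    have h1 : |ψ.1 e| ≤ 1 := (ψ.2 e).trans he
    calc |ψ.1 e * φ.1 v| = |ψ.1 e| * |φ.1 v| := abs_mul _ _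
      _ ≤ 1 * ‖v‖ := mul_le_mul h1 (φ.2 v) (abs_nonneg _) zero_le_one
      _ = ‖v‖ := one_mul _⟩

theorem rankOneAdj_mem {V : Type*} [NormedAddCommGroup V] [NormedSpace ℝ V] (φ : DualBall V)
    (e : V) (he : ‖e‖ ≤ 1) : rankOneAdj φ e he ∈ EnvSemigroup V := by
  refine subset_closure ⟨(WeakDual.toStrongDual φ.1).smulRight e, ?_, fun ψ v => ?_⟩
  · refine ContinuousLinearMap.opNorm_le_bound _ zero_le_one fun v => ?_
    calc ‖φ.1 v • e‖ = |φ.1 v| * ‖e‖ := norm_smul _ _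
      _ ≤ ‖v‖ * 1 := mul_le_mul (φ.2 v) he (norm_nonneg _) (norm_nonneg _)
      _ = 1 * ‖v‖ := mul_comm _ _
  · change ψ.1 e * φ.1 v = ψ.1 (φ.1 v • e)
    rw [map_smul, smul_eq_mul, mul_comm]

/-- A sequence in the unit ball on which functionals interpolate all bounded sequences gives
an embedding of `βℕ`. -/
theorem exists_isEmbedding_stoneCech {V : Type*} [NormedAddCommGroup V] [NormedSpace ℝ V]
    (e : ℕ → V) (he : ∀ n, ‖e n‖ ≤ 1) {κ : ℝ} (hκ : 0 < κ)
    (hinterp : ∀ g : ℕ → ℝ, (∀ n, |g n| ≤ 1) → ∃ ψ : DualBall V, ∀ n, ψ.1 (e n) = κ * g n) :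
    ∃ Φ : StoneCech ℕ → EnvSemigroup V, Topology.IsEmbedding Φ := by
  have he0 : ‖e 0‖ ≠ 0 := by
    obtain ⟨ψ, hψ⟩ := hinterp (fun _ => 1) (fun _ => by simp)
    intro h
    have := hψ 0
    rw [norm_eq_zero.1 h, map_zero] at this
    linarith
  obtain ⟨φ', hφ', hφe⟩ := exists_dual_vector ℝ (e 0) he0
  let φ : DualBall V := ⟨StrongDual.toWeakDual φ', fun v => by
    simpa using φ'.le_of_opNorm_le hφ'.le v⟩
  have hφ0 : φ.1 (e 0) ≠ 0 := by
    change φ' (e 0) ≠ 0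
    rw [hφe]; simpa using he0
  have _ : CompactSpace (EnvSemigroup V) := isCompact_iff_compactSpace.1 isClosed_closure.isCompact
  let u : ℕ → EnvSemigroup V := fun n => ⟨rankOneAdj φ (e n) (he n), rankOneAdj_mem φ (e n) (he n)⟩
  have hu : Continuous u := continuous_of_discreteTopology
  have hcont := continuous_stoneCechExtend hu
  refine ⟨stoneCechExtend hu, (hcont.isClosedEmbedding fun x y hxy => ?_).isEmbedding⟩
  by_contra hne
  obtain ⟨f, hfx, hfy, hf⟩ := exists_continuous_zero_one_of_isClosed
    (isClosed_singleton (x := x)) (isClosed_singleton (x := y)) (by simpa using hne)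
  obtain ⟨ψ, hψ⟩ := hinterp (fun n => f (stoneCechUnit n)) fun n =>
    abs_le.2 ⟨by linarith [(hf (stoneCechUnit n)).1], (hf _).2⟩
  have hc1 : Continuous fun z => ((stoneCechExtend hu z).1 ψ).1 (e 0) :=
    (dualBall_continuous_eval (e 0)).comp
      ((continuous_apply ψ).comp (continuous_subtype_val.comp hcont))
  have hc2 : Continuous fun z => κ * f z * φ.1 (e 0) :=
    (continuous_const.mul f.continuous).mul continuous_const
  have heq := stoneCech_hom_ext hc1 hc2 <| funext fun n => by
    simp only [Function.comp_apply, stoneCechExtend_stoneCechUnit]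
    rw [← hψ n]
    rfl
  have h1 := congrFun heq x
  have h2 := congrFun heq y
  simp only [hxy] at h1
  have hfx' : f x = 0 := hfx rfl
  have hfy' : f y = 1 := hfy rfl
  rw [h1, hfx', hfy', mul_zero, zero_mul, mul_one, zero_eq_mul] at h2
  exact h2.elim hκ.ne' hφ0

theorem exists_interpolating_seq {V : Type*} [NormedAddCommGroup V] [NormedSpace ℝ V]
    (hV : ContainsL1Copy V) :
    ∃ (e : ℕ → V) (κ : ℝ), (∀ n, ‖e n‖ ≤ 1) ∧ 0 < κ ∧
      ∀ g : ℕ → ℝ, (∀ n, |g n| ≤ 1) → ∃ ψ : DualBall V, ∀ n, ψ.1 (e n) = κ * g n := by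
  obtain ⟨f, c, hc, hf⟩ := hV
  have hM : 0 < ‖f‖ + 1 := by positivity
  refine ⟨fun n => (‖f‖ + 1)⁻¹ • f (lp.single 1 n 1), c / (‖f‖ + 1), fun n => ?_,
    div_pos hc hM, fun g hg => ?_⟩
  · rw [norm_smul, norm_inv, Real.norm_of_nonneg hM.le, inv_mul_le_iff₀ hM, mul_one]
    refine (f.le_opNorm _).trans ?_
    rw [lp.norm_single (by simp)]
    simp
  · obtain ⟨G, hG⟩ := exists_l1_map (V := ℝ) g 1 hg
    have hGnorm : ∀ x, ‖G x‖ ≤ ‖x‖ := fun x => by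
      rw [← (hG x).tsum_eq]
      refine tsum_of_norm_bounded (lp_one_hasSum_norm x) fun i => ?_
      rw [norm_smul]
      exact mul_le_of_le_one_right (norm_nonneg _) (hg i)
    have hGs : ∀ n, G (lp.single 1 n 1) = g n := fun n => by
      refine (hG _).unique ?_
      convert hasSum_single n fun i hi => ?_
      · simp
      · simp [hi]
    have hinj : Function.Injective f.toLinearMap := (injective_iff_map_eq_zero _).2 fun x hx => by
      have := hf x
      rw [show f x = 0 from hx, norm_zero] at this
      exact norm_le_zero_iff.1 (by nlinarith [norm_nonneg x])
    let L := LinearEquiv.ofInjective f.toLinearMap hinj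
    have hL : ∀ x, ((L x : f.toLinearMap.range) : V) = f x := fun x => rfl
    let ℓ : StrongDual ℝ f.toLinearMap.range :=
      ((c • G.toLinearMap).comp L.symm.toLinearMap).mkContinuous 1 fun y => by
        obtain ⟨x, rfl⟩ := L.surjective y
        have h1 : ‖c * G x‖ ≤ c * ‖x‖ := by
          rw [norm_mul, Real.norm_of_nonneg hc.le]
          exact mul_le_mul_of_nonneg_left (hGnorm x) hc.le
        simpa [hL] using h1.trans (hf x)
    obtain ⟨ψ, hψ, hψn⟩ := exists_extension_norm_eq _ ℓ
    have hψ1 : ‖ψ‖ ≤ 1 := hψn ▸ LinearMap.mkContinuous_norm_le _ zero_le_one _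
    refine ⟨⟨StrongDual.toWeakDual ψ, fun v => by simpa using ψ.le_of_opNorm_le hψ1 v⟩,
      fun n => ?_⟩
    have h1 : ψ (f (lp.single 1 n 1)) = c * g n := by
      rw [← hL, hψ, ← hGs]
      change c • G (L.symm (L _)) = _
      rw [L.symm_apply_apply, smul_eq_mul]
    change ψ ((‖f‖ + 1)⁻¹ • f (lp.single 1 n 1)) = _
    rw [map_smul, h1, smul_eq_mul]
    ring

open Cardinal in
theorem mk_envSemigroup_eq {V : Type*} [NormedAddCommGroup V] [NormedSpace ℝ V]
    [TopologicalSpace.SeparableSpace V] {Φ : StoneCech ℕ → EnvSemigroup V}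
    (hΦ : Function.Injective Φ) : #(EnvSemigroup V) = 2 ^ 𝔠 := by
  refine le_antisymm ?_ ?_
  · calc #(EnvSemigroup V) ≤ #(DualBall V → DualBall V) := mk_set_le _
      _ = #(DualBall V) ^ #(DualBall V) := rfl
      _ ≤ 𝔠 ^ #(DualBall V) := power_le_power_right (mk_dualBall_le V)
      _ ≤ 𝔠 ^ 𝔠 := power_le_power_left continuum_ne_zero (mk_dualBall_le V)
      _ = 2 ^ 𝔠 := by rw [power_self_eq aleph0_le_continuum]
  · have h := lift_mk_le_lift_mk_of_injective hΦ
    rw [lift_uzero] at h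
    refine le_trans ?_ h
    simpa using lift_le.2 two_power_continuum_le_mk_stoneCech

/-- BFT dichotomy for Banach spaces: for a separable Banach space `V`,
if `V` contains no copy of `ℓ¹` then `card E(V) ≤ 2^ℵ₀`; and if `V` contains a copy of
`ℓ¹` then `E(V)` contains a homeomorphic copy of `βℕ` and `card E(V) = 2^(2^ℵ₀)`. -/
theorem stmt6 (V : Type*) [NormedAddCommGroup V] [NormedSpace ℝ V] [CompleteSpace V]
    [TopologicalSpace.SeparableSpace V] :
    (¬ ContainsL1Copy V → Cardinal.mk (EnvSemigroup V) ≤ (2 : Cardinal) ^ Cardinal.aleph0) ∧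
    (ContainsL1Copy V →
      (∃ φ : StoneCech ℕ → EnvSemigroup V, Topology.IsEmbedding φ) ∧
      Cardinal.mk (EnvSemigroup V) = (2 : Cardinal) ^ ((2 : Cardinal) ^ Cardinal.aleph0)) := by
  refine ⟨fun hV => mk_envSemigroup_le hV, fun hV => ?_⟩
  obtain ⟨e, κ, he, hκ, hinterp⟩ := exists_interpolating_seq hV
  obtain ⟨Φ, hΦ⟩ := exists_isEmbedding_stoneCech e he hκ hinterp
  exact ⟨⟨Φ, hΦ⟩, mk_envSemigroup_eq hΦ.injective⟩
end

section
/- Let {V_i}_{i ∈ I} be a family of real Banach spaces, each containing no isomorphic copy of ℓ¹. Then the ℓ²-sum V = (Σ_{i ∈ I} V_i)_{ℓ²} — the Banach space of all families (x_i)_{i ∈ I} with x_i ∈ V_i and Σ_{i ∈ I} ‖x_i‖² < ∞, normed by ‖x‖ = (Σ_{i ∈ I} ‖x_i‖²)^{1/2} — contains no isomorphic copy of ℓ¹. -/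
/-- A bounded sequence satisfying a lower `ℓ¹`-estimate spans a copy of `ℓ¹`. -/
theorem ContainsL1Copy.of_seq {A : Type*} [NormedAddCommGroup A] [NormedSpace ℝ A]
    [CompleteSpace A] {u : ℕ → A} {C ε : ℝ} (hu : ∀ n, ‖u n‖ ≤ C) (hε : 0 < ε)
    (h : ∀ a : ℕ →₀ ℝ, ε * (a.sum fun _ r => |r|) ≤ ‖Finsupp.linearCombination ℝ u a‖) :
    ContainsL1Copy A := by
  have hnorm (x : lp (fun _ : ℕ => ℝ) 1) : HasSum (fun n => |x n|) ‖x‖ := by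
    simpa using lp.hasSum_norm (p := 1) (by simp) x
  have hle (x : lp (fun _ : ℕ => ℝ) 1) (n : ℕ) : ‖x n • u n‖ ≤ C * |x n| := by
    rw [norm_smul, Real.norm_eq_abs, mul_comm]
    exact mul_le_mul_of_nonneg_right (hu n) (abs_nonneg _)
  have hsum (x : lp (fun _ : ℕ => ℝ) 1) : Summable fun n => x n • u n :=
    Summable.of_norm_bounded ((hnorm x).summable.mul_left C) (hle x)
  let f : lp (fun _ : ℕ => ℝ) 1 →ₗ[ℝ] A :=
    { toFun := fun x => ∑' n, x n • u n
      map_add' := fun x y => by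
        rw [← (hsum x).tsum_add (hsum y)]
        simp [add_smul]
      map_smul' := fun r x => by
        rw [RingHom.id_apply, ← (hsum x).tsum_const_smul r]
        simp [mul_smul] }
  refine ⟨f.mkContinuous C fun x => tsum_of_norm_bounded ((hnorm x).mul_left C) (hle x),
    ε, hε, fun x => ?_⟩
  refine le_of_tendsto_of_tendsto' ((hnorm x).mul_left ε) (hsum x).hasSum.norm fun s => ?_
  have := h (Finsupp.indicator s fun n _ => x n)
  rw [Finsupp.linearCombination_apply, Finsupp.sum_indicator_index _ (by simp),
    Finsupp.sum_indicator_index _ (by simp)] at this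
  rwa [← Finset.mul_sum]

/-- In a space without a copy of `ℓ¹`, every bounded sequence has arbitrarily small
`ℓ¹`-normalized combinations. -/
theorem exists_norm_linearCombination_le_of_not_containsL1Copy {A : Type*}
    [NormedAddCommGroup A] [NormedSpace ℝ A] [CompleteSpace A] (hA : ¬ ContainsL1Copy A)
    {u : ℕ → A} {C ε : ℝ} (hu : ∀ n, ‖u n‖ ≤ C) (hε : 0 < ε) :
    ∃ b : ℕ →₀ ℝ, (b.sum fun _ r => |r|) = 1 ∧ ‖Finsupp.linearCombination ℝ u b‖ ≤ ε := by
  by_contra! H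
  refine hA (.of_seq hu hε fun a => ?_)
  have h0 : 0 ≤ a.sum fun _ r => |r| := Finset.sum_nonneg fun _ _ => abs_nonneg _
  rcases h0.eq_or_lt with h0 | h0
  · rw [← h0, mul_zero]
    exact norm_nonneg _
  · have h1 := H ((a.sum fun _ r => |r|)⁻¹ • a) <| by
      rw [Finsupp.sum_smul_index (by simp)]
      simp only [abs_mul, abs_inv, abs_of_pos h0]
      rw [← Finsupp.mul_sum, inv_mul_cancel₀ h0.ne']
    rw [map_smul, norm_smul, norm_inv, Real.norm_of_nonneg h0.le, inv_mul_eq_div,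
      lt_div_iff₀ h0] at h1
    exact h1.le

theorem Finsupp.norm_linearCombination_le {A : Type*} [NormedAddCommGroup A] [NormedSpace ℝ A]
    {α : Type*} {u : α → A} {C : ℝ} (hu : ∀ n, ‖u n‖ ≤ C) (a : α →₀ ℝ) :
    ‖Finsupp.linearCombination ℝ u a‖ ≤ C * a.sum fun _ r => |r| := by
  rw [Finsupp.linearCombination_apply, Finsupp.mul_sum]
  refine norm_sum_le_of_le _ fun n _ => ?_
  rw [norm_smul, Real.norm_eq_abs, mul_comm]
  exact mul_le_mul_of_nonneg_right (hu n) (abs_nonneg _)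

/-- Combinations of disjointly supported `ℓ¹`-normalized vectors preserve the `ℓ¹`-norm. -/
theorem Finsupp.sum_abs_linearCombination_of_pairwise_disjoint {b : ℕ → ℕ →₀ ℝ}
    (hb : ∀ k, ((b k).sum fun _ r => |r|) = 1)
    (hd : Pairwise fun k l => Disjoint (b k).support (b l).support) (a : ℕ →₀ ℝ) :
    ((Finsupp.linearCombination ℝ b a).sum fun _ r => |r|) = a.sum fun _ r => |r| := by
  classical
  induction a using Finsupp.induction with
  | zero => simp
  | single_add k r a hk _ ih =>
    rw [map_add, Finsupp.linearCombination_single, Finsupp.sum_add_index_of_disjoint, ih,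
      Finsupp.sum_add_index_of_disjoint, Finsupp.sum_single_index abs_zero,
      Finsupp.sum_smul_index (by simp)]
    · simp only [abs_mul]
      rw [← Finsupp.mul_sum, hb, mul_one]
    · refine Finset.disjoint_of_subset_left Finsupp.support_single_subset ?_
      simpa using hk
    · refine Finset.disjoint_of_subset_left Finsupp.support_smul ?_
      rw [Finsupp.linearCombination_apply]
      refine Finset.disjoint_of_subset_right Finsupp.support_finsetSum ?_
      rw [Finset.disjoint_biUnion_right]
      intro l hl
      refine Finset.disjoint_of_subset_right Finsupp.support_smul (hd ?_)
      rintro rfl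
      exact hk hl

/-- A bounded sequence has `ℓ¹`-normalized combinations, supported off any given finite set, whose
images under finitely many operators into spaces without copies of `ℓ¹` are small. -/
theorem exists_forall_norm_linearCombination_le {I X : Type*} {V : I → Type*}
    [NormedAddCommGroup X] [NormedSpace ℝ X] [∀ i, NormedAddCommGroup (V i)]
    [∀ i, NormedSpace ℝ (V i)] [∀ i, CompleteSpace (V i)] (h : ∀ i, ¬ ContainsL1Copy (V i))
    (R : ∀ i, X →L[ℝ] V i) {v : ℕ → X} {C ε : ℝ} (hv : ∀ n, ‖v n‖ ≤ C) (hε : 0 < ε)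
    (F : Finset I) (t : Finset ℕ) :
    ∃ b : ℕ →₀ ℝ, (b.sum fun _ r => |r|) = 1 ∧ Disjoint t b.support ∧
      ∀ i ∈ F, ‖R i (Finsupp.linearCombination ℝ v b)‖ ≤ ε := by
  classical
  induction F using Finset.induction_on generalizing t with
  | empty =>
    obtain ⟨n, hn⟩ := Infinite.exists_notMem_finset t
    refine ⟨Finsupp.single n 1, by simp, ?_, by simp⟩
    exact Finset.disjoint_of_subset_right Finsupp.support_single_subset (by simpa using hn)
  | insert j F _ ih =>
    have : Std.Symm fun a b : ℕ →₀ ℝ => Disjoint a.support b.support :=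
      ⟨fun _ _ hab => Disjoint.symm hab⟩
    obtain ⟨b, hb, hd⟩ := exists_seq_of_forall_finset_exists'
      (fun b : ℕ →₀ ℝ => (b.sum fun _ r => |r|) = 1 ∧ Disjoint t b.support ∧
        ∀ i ∈ F, ‖R i (Finsupp.linearCombination ℝ v b)‖ ≤ ε)
      (fun a b => Disjoint a.support b.support) (fun s _ => by
        obtain ⟨y, hy, hyt, hyF⟩ := ih (t ∪ s.biUnion Finsupp.support)
        rw [Finset.disjoint_union_left, Finset.disjoint_biUnion_left] at hyt
        exact ⟨y, ⟨hy, hyt.1, hyF⟩, hyt.2⟩)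
    have hw (k : ℕ) : ‖R j (Finsupp.linearCombination ℝ v (b k))‖ ≤ ‖R j‖ * C := by
      refine (R j).le_opNorm_of_le ?_
      simpa [(hb k).1] using Finsupp.norm_linearCombination_le hv (b k)
    obtain ⟨a, ha, haj⟩ := exists_norm_linearCombination_le_of_not_containsL1Copy (h j) hw hε
    have key (i : I) : R i (Finsupp.linearCombination ℝ v (Finsupp.linearCombination ℝ b a)) =
        Finsupp.linearCombination ℝ (fun k => R i (Finsupp.linearCombination ℝ v (b k))) a := by
      rw [Finsupp.linearCombination_linearCombination]
      exact Finsupp.apply_linearCombination ℝ (R i : X →ₗ[ℝ] V i) _ _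
    refine ⟨Finsupp.linearCombination ℝ b a, ?_, ?_, fun i hi => ?_⟩
    · rw [Finsupp.sum_abs_linearCombination_of_pairwise_disjoint (fun k => (hb k).1) hd, ha]
    · rw [Finsupp.linearCombination_apply]
      refine Finset.disjoint_of_subset_right Finsupp.support_finsetSum ?_
      rw [Finset.disjoint_biUnion_right]
      exact fun l _ => Finset.disjoint_of_subset_right Finsupp.support_smul (hb l).2.1
    · rw [key]
      rcases Finset.mem_insert.1 hi with rfl | hi
      · exact haj
      · simpa [ha] using Finsupp.norm_linearCombination_le (fun k => (hb k).2.2 i hi) a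

/-- For fixed `x` in an `ℓ²`-sum, vectors `y` that are small on a suitable finite set of coordinates
are almost orthogonal to `x`. -/
theorem lp.exists_finset_norm_add_sq_le {I : Type*} {V : I → Type*}
    [∀ i, NormedAddCommGroup (V i)] (x : lp V 2) :
    ∃ F : Finset I, ∃ ε > 0, ∀ y : lp V 2, (∀ i ∈ F, ‖y i‖ ≤ ε) →
      ‖x + y‖ ^ 2 ≤ ‖x‖ ^ 2 + 2 * ‖y‖ ^ 2 + 1 := by
  classical
  have hsq (z : lp V 2) : HasSum (fun i => ‖z i‖ ^ 2) (‖z‖ ^ 2) := by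
    simpa using lp.hasSum_norm (p := 2) (by simp) z
  obtain ⟨F, hF⟩ : ∃ F : Finset I, ‖x‖ ^ 2 - 1 / 2 < ∑ i ∈ F, ‖x i‖ ^ 2 :=
    ((hsq x).eventually (lt_mem_nhds (sub_lt_self _ one_half_pos))).exists
  have hS : 0 ≤ ∑ i ∈ F, ‖x i‖ := Finset.sum_nonneg fun _ _ => norm_nonneg _
  refine ⟨F, 1 / (4 * (∑ i ∈ F, ‖x i‖ + 1)), by positivity, fun y hy => ?_⟩
  set ε := 1 / (4 * (∑ i ∈ F, ‖x i‖ + 1)) with hε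
  have hFsum : HasSum (fun i => if i ∈ F then 2 * ε * ‖x i‖ - ‖x i‖ ^ 2 else 0)
      (∑ i ∈ F, (2 * ε * ‖x i‖ - ‖x i‖ ^ 2)) := by
    rw [← Finset.sum_congr rfl fun i hi => if_pos hi]
    exact hasSum_sum_of_ne_finset_zero fun i hi => if_neg hi
  have hle := hasSum_le (fun i => ?_) (hsq (x + y))
    ((((hsq x).mul_left 2).add ((hsq y).mul_left 2)).add hFsum)
  · rw [Finset.sum_sub_distrib, ← Finset.mul_sum] at hle
    have : 2 * ε * ∑ i ∈ F, ‖x i‖ ≤ 1 / 2 := by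
      rw [hε, mul_one_div, div_mul_eq_mul_div, div_le_iff₀ (by positivity)]
      linarith
    linarith
  · have h1 : ‖(x + y) i‖ ≤ ‖x i‖ + ‖y i‖ := norm_add_le _ _
    have h2 := pow_le_pow_left₀ (norm_nonneg _) h1 2
    split_ifs with hi
    · nlinarith [hy i hi, norm_nonneg (x i), norm_nonneg (y i),
        mul_le_mul_of_nonneg_left (hy i hi) (norm_nonneg (x i))]
    · nlinarith [sq_nonneg (‖x i‖ - ‖y i‖)]

/-- the `ℓ²`-sum of a family of Banach spaces, none of which contains an
isomorphic copy of `ℓ¹`, contains no isomorphic copy of `ℓ¹`. -/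
theorem stmt7 {I : Type*} (V : I → Type*) [∀ i, NormedAddCommGroup (V i)]
    [∀ i, NormedSpace ℝ (V i)] [∀ i, CompleteSpace (V i)]
    (h : ∀ i, ¬ ContainsL1Copy (V i)) :
    ¬ ContainsL1Copy (lp V 2) := by
  rintro ⟨f, c, hc, hf⟩
  let e (n : ℕ) : lp (fun _ : ℕ => ℝ) 1 := lp.single 1 n 1
  have he (a : ℕ →₀ ℝ) : ‖Finsupp.linearCombination ℝ e a‖ = a.sum fun _ r => |r| := by
    have := lp.norm_sum_single (E := fun _ : ℕ => ℝ) (p := 1) (by simp) a a.support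
    simp only [ENNReal.toReal_one, Real.rpow_one] at this
    simp [Finsupp.linearCombination_apply, Finsupp.sum, e, ← lp.single_smul, this]
  have hv (n : ℕ) : ‖f (e n)‖ ≤ ‖f‖ := by
    simpa [e] using f.le_opNorm (e n)
  have hfe (a : ℕ →₀ ℝ) : f (Finsupp.linearCombination ℝ e a) =
      Finsupp.linearCombination ℝ (fun n => f (e n)) a :=
    Finsupp.apply_linearCombination ℝ (f : lp (fun _ : ℕ => ℝ) 1 →ₗ[ℝ] lp V 2) e a
  have hump (m : ℕ) : ∃ a : ℕ →₀ ℝ, (a.sum fun _ r => |r|) = m ∧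
      ‖f (Finsupp.linearCombination ℝ e a)‖ ^ 2 ≤ m * (2 * ‖f‖ ^ 2 + 1) := by
    induction m with
    | zero => exact ⟨0, by simp, by simp⟩
    | succ m ih =>
      obtain ⟨a, ha, hax⟩ := ih
      obtain ⟨F, ε, hε, hF⟩ := lp.exists_finset_norm_add_sq_le (f (Finsupp.linearCombination ℝ e a))
      obtain ⟨b, hb, hd, hbF⟩ := exists_forall_norm_linearCombination_le h
        (fun i => lp.evalCLM ℝ V 2 i) hv hε F a.support
      have hy : ‖f (Finsupp.linearCombination ℝ e b)‖ ≤ ‖f‖ := by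
        simpa [he, hb] using f.le_opNorm (Finsupp.linearCombination ℝ e b)
      have hxy := hF (f (Finsupp.linearCombination ℝ e b)) fun i hi => by
        rw [hfe]
        exact hbF i hi
      refine ⟨a + b, ?_, ?_⟩
      · rw [Finsupp.sum_add_index_of_disjoint hd, ha, hb, Nat.cast_succ]
      · rw [map_add, map_add]
        push_cast
        nlinarith [pow_le_pow_left₀ (norm_nonneg _) hy 2]
  obtain ⟨m, hm⟩ := exists_nat_gt ((2 * ‖f‖ ^ 2 + 1) / c ^ 2)
  obtain ⟨a, ha, hax⟩ := hump m
  have hlow := hf (Finsupp.linearCombination ℝ e a)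
  rw [he, ha] at hlow
  have hm0 : (0 : ℝ) < m := lt_of_le_of_lt (by positivity) hm
  rw [div_lt_iff₀ (by positivity)] at hm
  nlinarith [pow_le_pow_left₀ (by positivity) hlow 2, mul_lt_mul_of_pos_left hm hm0]
end

section
/- Let S be a monoid acting on a compact Hausdorff space X such that every translation λ_s : X → X, x ↦ s·x, is continuous. If the enveloping semigroup E(X) is a Fréchet–Urysohn topological space, then every element p ∈ E(X) is a fragmented self-map of X (i.e., the system is tame). -/
/-- The enveloping semigroup of an action of `S` on `X`: the pointwise closure of the set
of translations `x ↦ s • x` in the product space `X^X`. -/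
def envSet (S X : Type*) [SMul S X] [TopologicalSpace X] : Set (X → X) :=
  closure {f : X → X | ∃ s : S, f = fun x => s • x}

open Filter Topology Uniformity in
theorem exists_isOpen_small_of_tendsto {Z Y : Type*} [TopologicalSpace Z] [BaireSpace Z]
    [Nonempty Z] [UniformSpace Y] {f : ℕ → Z → Y} {p : Z → Y} (hf : ∀ n, Continuous (f n))
    (hp : ∀ z, Tendsto (fun n => f n z) atTop (𝓝 (p z))) {ε : Set (Y × Y)} (hε : ε ∈ 𝓤 Y) :
    ∃ O : Set Z, IsOpen O ∧ O.Nonempty ∧ ∀ a ∈ O, ∀ b ∈ O, (p a, p b) ∈ ε := by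
  obtain ⟨W, hW, hWε⟩ := comp_mem_uniformity_sets hε
  obtain ⟨V', hV', hVW⟩ := comp_mem_uniformity_sets hW
  obtain ⟨V, ⟨hV, hVc⟩, hVV'⟩ := uniformity_hasBasis_closed.mem_iff.1 hV'
  have comp4 : ∀ {a b c d e : Y}, (a, b) ∈ V → (b, c) ∈ V → (c, d) ∈ V → (d, e) ∈ V →
      (a, e) ∈ ε := fun {a b c d e} h₁ h₂ h₃ h₄ =>
    hWε ⟨c, hVW ⟨b, hVV' h₁, hVV' h₂⟩, hVW ⟨d, hVV' h₃, hVV' h₄⟩⟩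
  let F : ℕ → Set Z := fun n => {z | ∀ i ≥ n, ∀ j ≥ n, (f i z, f j z) ∈ V}
  have hFc : ∀ n, IsClosed (F n) := fun n => by
    simp only [F, Set.ofPred_forall]
    exact isClosed_iInter fun i => isClosed_iInter fun _ => isClosed_iInter fun j =>
      isClosed_iInter fun _ => hVc.preimage ((hf i).prodMk (hf j))
  have hFU : ⋃ n, F n = Set.univ := by
    refine Set.eq_univ_of_forall fun z => Set.mem_iUnion.2 ?_
    obtain ⟨n, hn⟩ := cauchySeq_iff.1 (hp z).cauchySeq V hV
    exact ⟨n, fun i hi j hj => hn i hi j hj⟩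
  obtain ⟨n, z, hz⟩ := nonempty_interior_of_iUnion_of_closed hFc hFU
  have hlim : ∀ x ∈ F n, (f n x, p x) ∈ V ∧ (p x, f n x) ∈ V := fun x hx =>
    ⟨hVc.mem_of_tendsto (tendsto_const_nhds.prodMk_nhds (hp x))
      ((eventually_ge_atTop n).mono fun j hj => hx n le_rfl j hj),
    hVc.mem_of_tendsto ((hp x).prodMk_nhds tendsto_const_nhds)
      ((eventually_ge_atTop n).mono fun j hj => hx j hj n le_rfl)⟩
  have hnear : ∀ᶠ x in 𝓝 z, x ∈ F n ∧ (f n z, f n x) ∈ V ∧ (f n x, f n z) ∈ V :=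
    (eventually_mem_set.2 (mem_interior_iff_mem_nhds.1 hz)).and
      (((hf n).continuousAt.eventually (mem_nhds_left _ hV)).and
        ((hf n).continuousAt.eventually (mem_nhds_right _ hV)))
  obtain ⟨O, hO, hOo, hzO⟩ := eventually_nhds_iff.1 hnear
  refine ⟨O, hOo, ⟨z, hzO⟩, fun a ha b hb => ?_⟩
  obtain ⟨haF, -, haz⟩ := hO a ha
  obtain ⟨hbF, hzb, -⟩ := hO b hb
  exact comp4 (hlim a haF).2 haz hzb (hlim b hbF).1

open Filter Topology in
theorem isFragmentedMap_of_tendsto {X Y : Type*} [TopologicalSpace X] [CompactSpace X]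
    [T2Space X] [TopologicalSpace Y] [CompactSpace Y] [T2Space Y] {f : ℕ → X → Y} {p : X → Y}
    (hf : ∀ n, Continuous (f n)) (hp : ∀ x, Tendsto (fun n => f n x) atTop (𝓝 (p x))) :
    IsFragmentedMap p := by
  intro A hA ε hε
  let : UniformSpace Y := uniformSpaceOfCompactR1
  rw [nhdsSet_diagonal_eq_uniformity] at hε
  have : Nonempty (closure A) := hA.closure.to_subtype
  have : CompactSpace (closure A) := isCompact_iff_compactSpace.1 isClosed_closure.isCompact
  obtain ⟨O', hO', ⟨z, hz⟩, hsmall⟩ :=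
    exists_isOpen_small_of_tendsto (Z := closure A) (fun n => (hf n).comp continuous_subtype_val)
      (fun x => hp x) hε
  obtain ⟨O, hO, rfl⟩ := isOpen_induced_iff.1 hO'
  exact ⟨O, hO, mem_closure_iff.1 z.2 O hO hz, fun a ha b hb =>
    hsmall ⟨a, subset_closure ha.2⟩ ha.1 ⟨b, subset_closure hb.2⟩ hb.1⟩

/-- if the enveloping semigroup `E(X)` of a compact Hausdorff `S`-system with
continuous translations is a Fréchet–Urysohn space, then every element of `E(X)` is a
fragmented self-map of `X` (the system is tame). -/
theorem stmt9 {S X : Type*} [Monoid S] [TopologicalSpace X] [CompactSpace X] [T2Space X]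
    [MulAction S X]
    (hc : ∀ s : S, Continuous fun x : X => s • x)
    (hFU : FrechetUrysohnSpace (envSet S X)) :
    ∀ p ∈ envSet S X, IsFragmentedMap p := by
  intro p hp
  let T : Set (X → X) := {f | ∃ s : S, f = fun x => s • x}
  have hmem : (⟨p, hp⟩ : envSet S X) ∈ closure ((↑) ⁻¹' T : Set (envSet S X)) := by
    rw [closure_subtype, Subtype.image_preimage_coe,
      Set.inter_eq_right.2 (show T ⊆ envSet S X from subset_closure)]
    exact hp
  obtain ⟨u, hu, hlim⟩ := mem_closure_iff_seq_limit.1 hmem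
  refine isFragmentedMap_of_tendsto (f := fun n => (u n : X → X)) (fun n => ?_)
    (tendsto_pi_nhds.1 (tendsto_subtype_rng.1 hlim))
  obtain ⟨s, hs⟩ := hu n
  simpa only [hs] using hc s
end

section
/- Let P be a compact right topological admissible semigroup. If P is a Fréchet–Urysohn topological space, then for every a ∈ P the left translation λ_a : P → P, x ↦ a·x, is a fragmented self-map of P; that is, P is a tame semigroup. -/
open Filter Topology Uniformity in
/-- A pointwise limit of a sequence of continuous maps on a compact Hausdorff space is
fragmented: every nonempty set `A` has a relatively open nonempty part on which the limit
is `ε`-small. -/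
theorem exists_isOpen_small_of_tendsto_continuous {X Y : Type*} [TopologicalSpace X]
    [CompactSpace X] [T2Space X] [UniformSpace Y] {F : ℕ → X → Y} {f : X → Y}
    (hF : ∀ n, Continuous (F n)) (hf : ∀ x, Tendsto (fun n => F n x) atTop (𝓝 (f x)))
    {A : Set X} (hA : A.Nonempty) {ε : Set (Y × Y)} (hε : ε ∈ 𝓤 Y) :
    ∃ O : Set X, IsOpen O ∧ (O ∩ A).Nonempty ∧
      ∀ a ∈ O ∩ A, ∀ b ∈ O ∩ A, (f a, f b) ∈ ε := by
  obtain ⟨U, hU, hUsymm, hUε⟩ := comp_symm_mem_uniformity_sets hε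
  obtain ⟨W, hW, hWsymm, hWU⟩ := comp_symm_mem_uniformity_sets hU
  obtain ⟨V, hV, hVc, hVW⟩ := mem_uniformity_isClosed hW
  have : CompactSpace (closure A) := isCompact_iff_compactSpace.mp isClosed_closure.isCompact
  have : Nonempty (closure A) := hA.closure.to_subtype
  let K : ℕ → Set (closure A) := fun n => {x | ∀ m ≥ n, (F n x, F m x) ∈ V}
  have hKc : ∀ n, IsClosed (K n) := fun n => by
    simp only [K, Set.ofPred_forall]
    exact isClosed_iInter fun m => isClosed_iInter fun _ => hVc.preimage
      (((hF n).comp continuous_subtype_val).prodMk ((hF m).comp continuous_subtype_val))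
  have hKU : ⋃ n, K n = Set.univ := Set.eq_univ_of_forall fun x => by
    obtain ⟨N, hN⟩ := (hf x).cauchySeq.mem_entourage hV
    exact Set.mem_iUnion.mpr ⟨N, fun m hm => hN N m le_rfl hm⟩
  obtain ⟨n, y, hy⟩ := nonempty_interior_of_iUnion_of_closed hKc hKU
  obtain ⟨O, hO, hOK⟩ := isOpen_induced_iff.mp (isOpen_interior (s := K n))
  have hyO : (y : X) ∈ O := by rwa [← hOK] at hy
  obtain ⟨z, hzO, hzA⟩ := mem_closure_iff.mp y.2 O hO hyO
  have hlim : ∀ x ∈ O ∩ A, (F n x, f x) ∈ W := fun x hx => by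
    have hxK : (⟨x, subset_closure hx.2⟩ : closure A) ∈ K n :=
      interior_subset (hOK ▸ hx.1)
    exact hVW (hVc.mem_of_tendsto (tendsto_const_nhds.prodMk_nhds (hf x))
      (eventually_atTop.mpr ⟨n, fun m hm => hxK m hm⟩))
  obtain ⟨T, hT, hTo, hzT⟩ := mem_nhds_iff.mp
    ((hF n).continuousAt.preimage_mem_nhds (UniformSpace.ball_mem_nhds (F n z) hW))
  have hclose : ∀ x ∈ (O ∩ T) ∩ A, (F n z, f x) ∈ U := fun x hx =>
    hWU ⟨F n x, hT hx.1.2, hlim x ⟨hx.1.1, hx.2⟩⟩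
  exact ⟨O ∩ T, hO.inter hTo, ⟨z, ⟨hzO, hzT⟩, hzA⟩, fun a ha b hb =>
    hUε ⟨F n z, SetRel.symm U (hclose a ha), hclose b hb⟩⟩


/-- a compact right topological admissible semigroup which is a
Fréchet–Urysohn space is tame: all its left translations are fragmented. -/
theorem stmt10 {P : Type*} [Semigroup P] [TopologicalSpace P] [CompactSpace P] [T2Space P]
    (hright : ∀ a : P, Continuous fun x : P => x * a)
    (hadm : Dense {a : P | Continuous fun x : P => a * x})
    (hFU : FrechetUrysohnSpace P) :
    ∀ a : P, IsFragmentedMap fun x : P => a * x := by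
  intro a A hA ε hε
  let : UniformSpace P := uniformSpaceOfCompactR1
  obtain ⟨t, ht, hta⟩ := mem_closure_iff_seq_limit.mp (hadm a)
  exact exists_isOpen_small_of_tendsto_continuous ht
    (fun x => ((hright x).tendsto a).comp hta) hA (by rwa [nhdsSet_diagonal_eq_uniformity] at hε)
end

section
/- (Generalized Ellis theorem) Let P be a group carrying a compact Hausdorff topology such that every right translation ρ_a : P → P, x ↦ x·a, is continuous and the topological center Λ(P) = {a ∈ P : the left translation λ_a is continuous} is dense in P. If moreover every left translation λ_a : P → P, x ↦ a·x (a ∈ P), is a fragmented self-map of P, then P is a topological group: multiplication P × P → P is jointly continuous and inversion P → P is continuous. -/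
open Filter Topology Set

universe u

/-- A pointwise limit along a nonprincipal ultrafilter of continuous maps `g n` which are
independent over a pair of disjoint closed sets is not fragmented. -/
theorem not_isFragmentedMap_of_independent {X : Type u} {Y : Type*}
    [TopologicalSpace X] [CompactSpace X]
    [TopologicalSpace Y] {g : ℕ → X → Y} (hg : ∀ n, Continuous (g n))
    {C D : Set Y} (hC : IsClosed C) (hD : IsClosed D) (hCD : Disjoint C D)
    (hind : ∀ (α : ℕ → Bool) (n : ℕ), ∃ x, ∀ i < n, g i x ∈ bif α i then D else C)
    {q : X → Y} (hq : ∀ x, Tendsto (fun n => g n x) (hyperfilter ℕ) (𝓝 (q x))) :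
    ¬ IsFragmentedMap q := by
  intro hfrag
  let Z : Set (X × (ℕ → Bool)) := {d | ∀ n, g n d.1 ∈ bif d.2 n then D else C}
  have hcond : ∀ b : Bool, IsClosed (bif b then D else C) := by rintro (_ | _) <;> assumption
  have hZ : IsClosed Z := by
    have hZ' : Z = ⋂ n, ⋃ b : Bool,
        {d : X × (ℕ → Bool) | d.2 n = b} ∩ {d | g n d.1 ∈ bif b then D else C} := by
      ext d; simp [Z]
    rw [hZ']
    refine isClosed_iInter fun n => isClosed_iUnion_of_finite fun b => IsClosed.inter ?_ ?_
    · exact isClosed_eq (by fun_prop) continuous_const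
    · exact (hcond b).preimage ((hg n).comp continuous_fst)
  have : CompactSpace Z := isCompact_iff_compactSpace.mp hZ.isCompact
  let π : Z → ULift.{u} (ℕ → Bool) := fun d => ULift.up d.1.2
  have hπ : Continuous π := continuous_uliftUp.comp (by fun_prop)
  have hsurj : Function.Surjective π := by
    rintro ⟨α⟩
    obtain ⟨x, hx⟩ : (⋂ n, {x | ∀ i < n, g i x ∈ bif α i then D else C}).Nonempty := by
      have hcl : ∀ n, IsClosed {x | ∀ i < n, g i x ∈ bif α i then D else C} := fun n => by
        simp only [ofPred_forall]
        exact isClosed_biInter fun i _ => (hcond _).preimage (hg i)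
      exact IsCompact.nonempty_iInter_of_sequence_nonempty_isCompact_isClosed _
        (fun n x hx i hi => hx i (hi.trans n.lt_succ_self)) (hind α) (hcl 0).isCompact hcl
    exact ⟨⟨(x, α), fun n => mem_iInter.1 hx (n + 1) n n.lt_succ_self⟩, rfl⟩
  obtain ⟨E, _, hE, hmin⟩ := exists_compact_surjective_zorn_subset hπ hsurj
  have hlift : ∀ α : ℕ → Bool, ∃ d : E, d.1.1.2 = α := fun α => by
    obtain ⟨d, hd, h⟩ := hE.symm ▸ mem_univ (ULift.up α)
    exact ⟨⟨d, hd⟩, congrArg ULift.down h⟩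
  have hε : (C ×ˢ D)ᶜ ∈ nhdsSet (diagonal Y) :=
    (hC.prod hD).isOpen_compl.mem_nhdsSet.2 fun ⟨x, y⟩ hxy h => by
      obtain rfl : x = y := hxy
      exact disjoint_left.1 hCD h.1 h.2
  obtain ⟨d₀, -⟩ := hlift fun _ => true
  obtain ⟨O, hO, ⟨_, hxO, ⟨d, rfl⟩⟩, hsmall⟩ :=
    hfrag (range fun d : E => d.1.1.1) ⟨_, d₀, rfl⟩ _ hε
  let E₀ : Set E := {d | d.1.1.1 ∉ O}
  have hE₀ : IsClosed E₀ := hO.isClosed_compl.preimage (by fun_prop)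
  have himg : IsClosed (E.domRestrict π '' E₀) :=
    (hE₀.isCompact.image hπ.continuousOn.domRestrict).isClosed
  obtain ⟨⟨α⟩, hα⟩ := (ne_univ_iff_exists_notMem _).1 <|
    hmin E₀ (fun h => (h ▸ mem_univ d : d ∈ E₀) hxO) hE₀
  have htail : ∀ b : Bool, Tendsto (fun n : ℕ => fun i => if i < n then α i else b) atTop (𝓝 α) :=
    fun b => tendsto_pi_nhds.2 fun i => tendsto_const_nhds.congr' <|
      (eventually_gt_atTop i).mono fun n hn => by simp [hn]
  have hpick : ∀ b : Bool, ∃ x ∈ O ∩ range fun d : E => d.1.1.1, q x ∈ bif b then D else C := by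
    intro b
    obtain ⟨n, hn⟩ := ((continuous_uliftUp.tendsto α).comp (htail b) |>.eventually
      (himg.isOpen_compl.mem_nhds hα)).exists
    obtain ⟨e, he⟩ := hlift fun i => if i < n then α i else b
    refine ⟨e.1.1.1, ⟨by_contra fun h => hn ⟨e, h, congrArg ULift.up he⟩, e, rfl⟩,
      (hcond b).mem_of_tendsto (hq _) ?_⟩
    refine Nat.hyperfilter_le_atTop ((eventually_ge_atTop n).mono fun i hi => ?_)
    have := e.1.2 i
    rw [he] at this
    simpa [hi.not_gt] using this
  obtain ⟨x, hx, hxC⟩ := hpick false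
  obtain ⟨y, hy, hyD⟩ := hpick true
  exact hsmall x hx y hy ⟨hxC, hyD⟩

/-- If `k` is a cluster value of `p * x` as `x → 1`, then elements of the topological center
move suitable points of prescribed small open sets by about `p⁻¹ * k`, and other points of the
same sets hardly at all. -/
theorem exists_mul_mem_and_mul_mem {P : Type*} [Group P] [TopologicalSpace P]
    (hright : ∀ a : P, Continuous fun x : P => x * a)
    (hadm : Dense {a : P | Continuous fun x : P => a * x})
    {p k : P} (hk : MapClusterPt k (𝓝 1) fun x => p * x)
    {W B : Set P} (hW : IsOpen W) (hB : IsOpen B) (hWB : ∀ z ∈ W, z * (p⁻¹ * k) ∈ B)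
    {𝓦 : Set (Set P)} (hfin : 𝓦.Finite)
    (h𝓦 : ∀ w ∈ 𝓦, IsOpen w ∧ w.Nonempty ∧ w ⊆ W) :
    ∃ g : P, Continuous (fun x => g * x) ∧
      ∀ w ∈ 𝓦, (∃ y ∈ w, g * y ∈ W) ∧ ∃ y ∈ w, g * y ∈ B := by
  have near : ∀ {q a : P} {V : Set P}, IsOpen V → q * a ∈ V → ∀ᶠ h in 𝓝 q, h * a ∈ V :=
    fun hV hq => (hright _).continuousAt.eventually (hV.mem_nhds hq)
  have approx : ∀ {q : P} {Q : P → Prop}, (∀ᶠ h in 𝓝 q, Q h) →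
      ∃ h, Continuous (fun x => h * x) ∧ Q h := fun hQ =>
    ((mem_closure_iff_frequently.1 (hadm _)).and_eventually hQ).exists
  suffices H : ∃ g : P, Continuous (fun x => g * x) ∧
      (∀ w ∈ 𝓦, ∃ y ∈ w, g * y ∈ W) ∧ ∀ w ∈ 𝓦, ∃ y ∈ w, g * y ∈ B by
    obtain ⟨g, hg, h₁, h₂⟩ := H
    exact ⟨g, hg, fun w hw => ⟨h₁ w hw, h₂ w hw⟩⟩
  refine Set.Finite.induction_on_subset (motive := fun t _ => ∃ g : P, Continuous (fun x => g * x) ∧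
      (∀ w ∈ 𝓦, ∃ y ∈ w, g * y ∈ W) ∧ ∀ w ∈ t, ∃ y ∈ w, g * y ∈ B) 𝓦 hfin ?_ ?_
  · obtain ⟨g, hg, hgW⟩ := approx (q := (1 : P)) (Q := fun g => ∀ w ∈ 𝓦, ∃ y ∈ w, g * y ∈ W) <|
      (eventually_all_finite hfin).2 fun w hw => by
        obtain ⟨hwo, ⟨y, hy⟩, hwW⟩ := h𝓦 w hw
        exact (near hW (by simpa using hwW hy)).mono fun g hg => ⟨y, hy, hg⟩
    exact ⟨g, hg, hgW, by simp⟩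
  · rintro v t hv ht - ⟨g, hg, hgW, hgB⟩
    obtain ⟨y₀, hy₀, hy₀W⟩ := hgW v hv
    obtain ⟨y, hy, hyv, hyW⟩ := hadm.exists_mem_open ((h𝓦 v hv).1.inter (hW.preimage hg))
      ⟨y₀, hy₀, hy₀W⟩
    have hyB := hWB _ hyW
    choose! a ha haW using hgW
    choose! b hb hbB using hgB
    set z := g * y with hz
    obtain ⟨h, hh, ⟨hhW, hhB⟩, hhk⟩ := approx (q := z * p⁻¹) <|
      (((eventually_all_finite hfin).2 fun w hw => near (a := p * z⁻¹ * (g * a w)) hW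
        (by simpa [mul_assoc] using haW w hw)).and
      ((eventually_all_finite (hfin.subset ht)).2 fun w hw => near (a := p * z⁻¹ * (g * b w)) hB
        (by simpa [mul_assoc] using hbB w hw))).and
      (near (a := k) hB (by simpa [z, mul_assoc] using hyB))
    obtain ⟨x, hxB, hxv⟩ := ((mapClusterPt_iff_frequently.1 hk _
      ((hB.preimage hh).mem_nhds hhk)).and_eventually
      (hy.continuousAt.eventually ((h𝓦 v hv).1.mem_nhds (by simpa using hyv)))).exists
    obtain ⟨f, hf, ⟨hfW, hfB⟩, hfx⟩ := approx (q := p * z⁻¹) <|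
      (((eventually_all_finite hfin).2 fun w hw => near (a := g * a w) (hW.preimage hh)
        (hhW w hw)).and
      ((eventually_all_finite (hfin.subset ht)).2 fun w hw => near (a := g * b w) (hB.preimage hh)
        (hhB w hw))).and
      (near (a := z * x) (hB.preimage hh) (by simpa [mul_assoc] using hxB))
    refine ⟨h * (f * g), ?_, fun w hw => ⟨a w, ha w hw, ?_⟩, ?_⟩
    · simpa only [mul_assoc, Function.comp_def] using hh.comp (hf.comp hg)
    · simpa only [mul_assoc, mem_preimage] using hfW w hw
    · rintro w (rfl | hw)
      · exact ⟨y * x, hxv, by simpa only [hz, mul_assoc, mem_preimage] using hfx⟩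
      · exact ⟨b w, hb w hw, by simpa only [mul_assoc, mem_preimage] using hfB w hw⟩

/-- A compact Hausdorff group with continuous right translations, dense topological center and
fragmented left translations has continuous left translations. -/
theorem continuous_mul_left_of_isFragmentedMap {P : Type*} [Group P] [TopologicalSpace P]
    [CompactSpace P] [T2Space P]
    (hright : ∀ a : P, Continuous fun x : P => x * a)
    (hadm : Dense {a : P | Continuous fun x : P => a * x})
    (hfrag : ∀ a : P, IsFragmentedMap fun x : P => a * x) (p : P) :
    Continuous fun x : P => p * x := by
  suffices h1 : ContinuousAt (fun x => p * x) 1 by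
    refine continuous_iff_continuousAt.2 fun w => ?_
    have h2 : ContinuousAt (fun x => p * (x * w⁻¹)) w :=
      ContinuousAt.comp (f := fun x : P => x * w⁻¹) (by simpa using h1) (hright _).continuousAt
    simpa [Function.comp_def, mul_assoc] using (hright w).continuousAt.comp h2
  by_contra hp
  obtain ⟨V, hV, hVo, hpV⟩ : ∃ V, IsOpen V ∧ p ∈ V ∧ ∃ᶠ x in 𝓝 (1 : P), p * x ∈ Vᶜ := by
    by_contra! H
    refine hp (tendsto_nhds.2 fun s hs hps => ?_)
    exact (H s hs (by simpa using hps)).mono fun _ => not_not.1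
  obtain ⟨k, hkV, hk⟩ := hV.isClosed_compl.isCompact.exists_mapClusterPt_of_frequently hpV
  have hne : (1 : P) ≠ p⁻¹ * k := fun h => hkV (by rwa [inv_mul_eq_one.1 h.symm] at hVo)
  obtain ⟨A, h1A, hA, B, hkB, hB, hAB⟩ := exists_open_nhds_disjoint_closure hne
  set W : Set P := A ∩ (fun x => x * (p⁻¹ * k)) ⁻¹' B
  have hW : IsOpen W := hA.inter (hB.preimage (hright _))
  have h1W : (1 : P) ∈ W := ⟨h1A, by simpa using hkB⟩
  let T := {𝓦 : Set (Set P) // 𝓦.Finite ∧ ∀ w ∈ 𝓦, IsOpen w ∧ w.Nonempty ∧ w ⊆ W}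
  have hstep : ∀ t : T, ∃ g : P, Continuous (fun x => g * x) ∧
      ∀ w ∈ t.1, (∃ y ∈ w, g * y ∈ W) ∧ ∃ y ∈ w, g * y ∈ B := fun t =>
    exists_mul_mem_and_mul_mem hright hadm hk hW hB (fun z hz => hz.2) t.2.1 t.2.2
  choose G hG hGT using hstep
  let next : T → T := fun t =>
    ⟨(fun w => w ∩ (fun x => G t * x) ⁻¹' W) '' t.1 ∪
        (fun w => w ∩ (fun x => G t * x) ⁻¹' B) '' t.1,
      (t.2.1.image _).union (t.2.1.image _), by
      rintro _ (⟨w, hw, rfl⟩ | ⟨w, hw, rfl⟩)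
      · exact ⟨(t.2.2 w hw).1.inter (hW.preimage (hG t)), (hGT t w hw).1,
          inter_subset_left.trans (t.2.2 w hw).2.2⟩
      · exact ⟨(t.2.2 w hw).1.inter (hB.preimage (hG t)), (hGT t w hw).2,
          inter_subset_left.trans (t.2.2 w hw).2.2⟩⟩
  let t₀ : T := ⟨{W}, finite_singleton W, by rintro _ rfl; exact ⟨hW, ⟨1, h1W⟩, subset_rfl⟩⟩
  let t : ℕ → T := fun n => next^[n] t₀
  have ht : ∀ n, t (n + 1) = next (t n) := fun n => Function.iterate_succ_apply' _ _ _
  have hind : ∀ (α : ℕ → Bool) (n : ℕ), ∃ w ∈ (t n).1, ∀ x ∈ w, ∀ i < n,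
      G (t i) * x ∈ bif α i then closure B else closure A := by
    intro α n
    induction n with
    | zero => exact ⟨W, rfl, by simp⟩
    | succ n ih =>
      obtain ⟨w, hw, hwα⟩ := ih
      rw [ht]
      cases hα : α n with
      | false =>
        refine ⟨_, Or.inl ⟨w, hw, rfl⟩, fun x hx i hi => ?_⟩
        rcases Nat.lt_succ_iff_lt_or_eq.1 hi with hi | rfl
        · exact hwα x hx.1 i hi
        · simpa [hα] using subset_closure hx.2.1
      | true =>
        refine ⟨_, Or.inr ⟨w, hw, rfl⟩, fun x hx i hi => ?_⟩
        rcases Nat.lt_succ_iff_lt_or_eq.1 hi with hi | rfl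
        · exact hwα x hx.1 i hi
        · simpa [hα] using subset_closure (mem_preimage.1 hx.2)
  obtain ⟨q, -, hq⟩ := isCompact_univ.ultrafilter_le_nhds
    ((hyperfilter ℕ).map fun n => G (t n)) (by simp)
  refine not_isFragmentedMap_of_independent (g := fun n x => G (t n) * x) (fun n => hG _)
    isClosed_closure isClosed_closure hAB (fun α n => ?_)
    (fun x => ((hright x).tendsto q).comp hq) (hfrag q)
  obtain ⟨w, hw, hwα⟩ := hind α n
  obtain ⟨x, hx⟩ := ((t n).2.2 w hw).2.1
  exact ⟨x, hwα x hx⟩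

/-- **Ellis theorem** for compact groups: separate continuity of multiplication implies joint
continuity. -/
theorem continuous_mul_of_separately_continuous {P : Type*} [Group P] [TopologicalSpace P]
    [CompactSpace P] [T2Space P] (hright : ∀ a : P, Continuous fun x : P => x * a)
    (hleft : ∀ a : P, Continuous fun x : P => a * x) :
    Continuous fun x : P × P => x.1 * x.2 := by
  suffices h1 : ContinuousAt (fun x : P × P => x.1 * x.2) (1, 1) by
    refine continuous_iff_continuousAt.2 fun ⟨a, b⟩ => ?_
    have h2 : ContinuousAt (fun x : P × P => (a⁻¹ * x.1) * (x.2 * b⁻¹)) (a, b) :=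
      ContinuousAt.comp (g := fun x : P × P => x.1 * x.2)
        (f := fun x : P × P => (a⁻¹ * x.1, x.2 * b⁻¹)) (by simpa using h1)
        (((hleft _).comp continuous_fst).prodMk ((hright _).comp continuous_snd)).continuousAt
    simpa [Function.comp_def, mul_assoc] using
      ((hleft a).comp (hright b)).continuousAt.comp h2
  by_contra hp
  obtain ⟨V, hV, h1V, hpV⟩ : ∃ V, IsOpen V ∧ (1 : P) ∈ V ∧
      ∃ᶠ x in 𝓝 ((1 : P), (1 : P)), x.1 * x.2 ∈ Vᶜ := by
    by_contra! H
    refine hp (tendsto_nhds.2 fun s hs hps => ?_)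
    exact (H s hs (by simpa using hps)).mono fun _ => not_not.1
  obtain ⟨k, hkV, hk⟩ := hV.isClosed_compl.isCompact.exists_mapClusterPt_of_frequently hpV
  have hne : 1 ≠ k := by rintro rfl; exact hkV h1V
  obtain ⟨A', h1A', hA', B, hkB, hB, hAB'⟩ := exists_open_nhds_disjoint_closure hne
  set A : Set P := A' ∩ (fun x => x * k) ⁻¹' B
  have hA : IsOpen A := hA'.inter (hB.preimage (hright _))
  have h1A : (1 : P) ∈ A := ⟨h1A', by simpa using hkB⟩
  have hAB : Disjoint (closure A) (closure B) :=
    hAB'.mono_left (closure_mono inter_subset_left)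
  let T := {t : Set P × Set P // (IsOpen t.1 ∧ t.1.Nonempty ∧ t.1 ⊆ A) ∧ IsOpen t.2 ∧ 1 ∈ t.2}
  have hstep : ∀ t : T, ∃ g ∈ t.1.1, ∃ w ∈ t.1.2, g * w ∈ B := by
    rintro ⟨⟨U, S⟩, ⟨hU, ⟨c, hc⟩, hUA⟩, hS, h1S⟩
    have hev : ∀ᶠ x : P × P in 𝓝 (1, 1), c * x.1 ∈ U ∧ x.2 ∈ S :=
      (((hleft c).comp continuous_fst).continuousAt.eventually
        (hU.mem_nhds (by simpa using hc))).and
        (continuous_snd.continuousAt.eventually (hS.mem_nhds h1S))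
    obtain ⟨x, hxB, hxU, hxS⟩ := ((mapClusterPt_iff_frequently.1 hk _
      ((hB.preimage (hleft c)).mem_nhds (hUA hc).2)).and_eventually hev).exists
    exact ⟨c * x.1, hxU, x.2, hxS, by simpa [mul_assoc] using hxB⟩
  choose g hg w hw hgw using hstep
  let next : T → T := fun t => ⟨(t.1.1 ∩ (fun x => x * w t) ⁻¹' B, t.1.2 ∩ (fun x => g t * x) ⁻¹' A),
    ⟨t.2.1.1.inter (hB.preimage (hright _)), ⟨g t, hg t, hgw t⟩,
      inter_subset_left.trans t.2.1.2.2⟩,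
    t.2.2.1.inter (hA.preimage (hleft _)), t.2.2.2, by simpa using t.2.1.2.2 (hg t)⟩
  let t₀ : T := ⟨(A, univ), ⟨hA, ⟨1, h1A⟩, subset_rfl⟩, isOpen_univ, mem_univ 1⟩
  let t : ℕ → T := fun n => next^[n] t₀
  have ht : ∀ n, t (n + 1) = next (t n) := fun n => Function.iterate_succ_apply' _ _ _
  have hanti : Antitone fun n => (t n).1 := antitone_nat_of_succ_le fun n => by
    rw [ht]
    exact ⟨inter_subset_left, inter_subset_left⟩
  have hgB : ∀ m n, m < n → g (t n) * w (t m) ∈ B := fun m n hmn => by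
    have : g (t n) ∈ (t (m + 1)).1.1 := (hanti (Nat.succ_le_of_lt hmn)).1 (hg (t n))
    rw [ht] at this
    exact this.2
  have hwA : ∀ m n, m < n → g (t m) * w (t n) ∈ A := fun m n hmn => by
    have : w (t n) ∈ (t (m + 1)).1.2 := (hanti (Nat.succ_le_of_lt hmn)).2 (hw (t n))
    rw [ht] at this
    exact this.2
  obtain ⟨a, -, ha⟩ := isCompact_univ.ultrafilter_le_nhds
    ((hyperfilter ℕ).map fun n => g (t n)) (by simp)
  obtain ⟨b, -, hb⟩ := isCompact_univ.ultrafilter_le_nhds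
    ((hyperfilter ℕ).map fun n => w (t n)) (by simp)
  have hlt : ∀ m : ℕ, ∀ᶠ n in hyperfilter ℕ, m < n := fun m =>
    Nat.hyperfilter_le_atTop (eventually_gt_atTop m)
  suffices h : a * b ∈ closure A ∧ a * b ∈ closure B from disjoint_left.1 hAB h.1 h.2
  constructor
  · refine isClosed_closure.mem_of_tendsto (((hright b).tendsto a).comp ha)
      (Eventually.of_forall fun m => ?_)
    exact mem_closure_of_tendsto (((hleft (g (t m))).tendsto b).comp hb)
      ((hlt m).mono fun n hn => hwA m n hn)
  · refine isClosed_closure.mem_of_tendsto (((hleft a).tendsto b).comp hb)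
      (Eventually.of_forall fun m => ?_)
    exact mem_closure_of_tendsto (((hright (w (t m))).tendsto a).comp ha)
      ((hlt m).mono fun n hn => hgB m n hn)

/-- Generalized Ellis theorem: a compact Hausdorff right topological
admissible group all of whose left translations are fragmented is a topological group. -/
theorem stmt11 {P : Type*} [Group P] [TopologicalSpace P] [CompactSpace P] [T2Space P]
    (hright : ∀ a : P, Continuous fun x : P => x * a)
    (hadm : Dense {a : P | Continuous fun x : P => a * x})
    (hfrag : ∀ a : P, IsFragmentedMap fun x : P => a * x) :
    Continuous (fun p : P × P => p.1 * p.2) ∧ Continuous (fun p : P => p⁻¹) := by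
  have hmul : Continuous fun p : P × P => p.1 * p.2 :=
    continuous_mul_of_separately_continuous hright
      (continuous_mul_left_of_isFragmentedMap hright hadm hfrag)
  refine ⟨hmul, continuous_iff_ultrafilter.2 fun a F hF => ?_⟩
  obtain ⟨b, -, hb⟩ := isCompact_univ.ultrafilter_le_nhds (F.map fun x => x⁻¹) (by simp)
  have hab : Tendsto (fun x : P => x * x⁻¹) F (𝓝 (a * b)) :=
    (hmul.tendsto (a, b)).comp (Tendsto.prodMk_nhds hF hb)
  simp only [mul_inv_cancel] at hab
  rwa [inv_eq_of_mul_eq_one_right (tendsto_nhds_unique tendsto_const_nhds hab).symm]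
end
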